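/- Let D be a connected C-homogeneous digraph with more than one end. Then D is of Type I if and only if the underlying undirected graph of D is a tree or D contains a triangle. -/

import Mathlib

open Set

universe u

/-- The underlying undirected graph of a digraph given by its edge relation. -/
def UG {V : Type u} (E : V → V → Prop) : SimpleGraph V := SimpleGraph.fromRel E

/-- `E` is a digraph edge relation: irreflexive and antisymmetric. -/
def IsDigraph {V : Type u} (E : V → V → Prop) : Prop :=
  (∀ x, ¬ E x x) ∧ ∀ x y, E x y → ¬ E y x

/-- A ray in a graph: a one-way infinite path. -/
def IsRay {V : Type u} (G : SimpleGraph V) (r : ℕ → V) : Prop :=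
  Function.Injective r ∧ ∀ n, G.Adj (r n) (r (n + 1))

/-- A sequence is eventually in a set. -/
def EventuallyIn {V : Type u} (r : ℕ → V) (C : Set V) : Prop :=
  ∃ N, ∀ n, N ≤ n → r n ∈ C

/-- `C` is a connected component of the subgraph of `G` induced on `W`:
a maximal connected subset of `W`. -/
def IsCompOf {V : Type u} (G : SimpleGraph V) (C W : Set V) : Prop :=
  C.Nonempty ∧ C ⊆ W ∧ (G.induce C).Connected ∧
    ∀ C', C ⊆ C' → C' ⊆ W → (G.induce C').Connected → C' = C

/-- Two rays are equivalent if for every finite vertex set `S` they lie eventually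
in the same component of the graph minus `S`. -/
def RayEquiv {V : Type u} (G : SimpleGraph V) (r r' : ℕ → V) : Prop :=
  ∀ S : Finset V, ∃ C : Set V, IsCompOf G C {v | v ∉ S} ∧
    EventuallyIn r C ∧ EventuallyIn r' C

/-- The graph has more than one end: two inequivalent rays. -/
def MoreThanOneEnd {V : Type u} (G : SimpleGraph V) : Prop :=
  ∃ r r' : ℕ → V, IsRay G r ∧ IsRay G r' ∧ ¬ RayEquiv G r r'

/-- The graph has infinitely many ends: arbitrarily large families of pairwise
inequivalent rays. -/
def InfinitelyManyEnds {V : Type u} (G : SimpleGraph V) : Prop :=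
  ∀ n : ℕ, ∃ f : Fin n → (ℕ → V), (∀ i, IsRay G (f i)) ∧
    ∀ i j, i ≠ j → ¬ RayEquiv G (f i) (f j)

/-- A separation of a graph: a pair of vertex sets covering `V` such that every
edge lies within one side. -/
def IsSeparation {V : Type u} (G : SimpleGraph V) (c : Set V × Set V) : Prop :=
  c.1 ∪ c.2 = univ ∧ ∀ x y, G.Adj x y → (x ∈ c.1 ∧ y ∈ c.1) ∨ (x ∈ c.2 ∧ y ∈ c.2)

/-- The order of a separation: the number of vertices in its separator. -/
noncomputable def sepOrder {V : Type u} (c : Set V × Set V) : ℕ := (c.1 ∩ c.2).ncard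

/-- The neighbourhood of a vertex set. -/
def Nbhd {V : Type u} (G : SimpleGraph V) (A : Set V) : Set V :=
  {v | v ∉ A ∧ ∃ u ∈ A, G.Adj u v}

/-- The separation `(A, ∼)`. -/
def tildeSep {V : Type u} (G : SimpleGraph V) (A : Set V) : Set V × Set V :=
  (A, Aᶜ ∪ Nbhd G Aᶜ)

/-- `S` separates the wings of the separation `c`: every walk from one wing to
the other meets `S`. -/
def SeparatesWings {V : Type u} (G : SimpleGraph V) (c : Set V × Set V) (S : Set V) : Prop :=
  ∀ a ∈ c.1 \ c.2, ∀ b ∈ c.2 \ c.1, ∀ w : G.Walk a b, ∃ v ∈ w.support, v ∈ S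

/-- A separation of finite order with non-empty wings is essential if its first wing is
connected and no proper subset of the separator separates the wings. -/
def IsEssential {V : Type u} (G : SimpleGraph V) (c : Set V × Set V) : Prop :=
  IsSeparation G c ∧ (c.1 ∩ c.2).Finite ∧ (c.1 \ c.2).Nonempty ∧ (c.2 \ c.1).Nonempty ∧
  (G.induce (c.1 \ c.2)).Connected ∧
  ∀ S, S ⊂ c.1 ∩ c.2 → ¬ SeparatesWings G c S

/-- `C` is a wing of some separation in `𝒞`. -/
def IsWingOf {V : Type u} (𝒞 : Set (Set V × Set V)) (C : Set V) : Prop :=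
  ∃ d ∈ 𝒞, C = d.1 \ d.2 ∨ C = d.2 \ d.1

/-- A cut system. -/
def IsCutSystem {V : Type u} (G : SimpleGraph V) (𝒞 : Set (Set V × Set V)) : Prop :=
  𝒞.Nonempty ∧ (∀ c ∈ 𝒞, IsEssential G c) ∧
  (∀ c ∈ 𝒞, ∃ d ∈ 𝒞, d.1 ⊆ c.2) ∧
  (∀ c ∈ 𝒞, ∀ C : Set V, IsCompOf G C (c.2 \ c.1) →
    (∃ d ∈ 𝒞, d.1 \ d.2 ⊆ C) → tildeSep G (C ∪ Nbhd G C) ∈ 𝒞) ∧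
  (∀ c ∈ 𝒞, ∀ c' ∈ 𝒞, ∃ C₁ C₂ : Set V,
    ((IsCompOf G C₁ ((c.1 \ c.2) ∩ (c'.1 \ c'.2)) ∧
      IsCompOf G C₂ ((c.2 \ c.1) ∩ (c'.2 \ c'.1))) ∨
     (IsCompOf G C₁ ((c.2 \ c.1) ∩ (c'.1 \ c'.2)) ∧
      IsCompOf G C₂ ((c.1 \ c.2) ∩ (c'.2 \ c'.1)))) ∧
    IsWingOf 𝒞 C₁ ∧ IsWingOf 𝒞 C₂)

/-- Pick a side of a separation. -/
def pickSide {V : Type u} (c : Set V × Set V) : Bool → Set V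
  | false => c.1
  | true => c.2

/-- Two cuts are nested (with respect to the cut system `𝒞`). -/
def NestedPair {V : Type u} (G : SimpleGraph V) (𝒞 : Set (Set V × Set V))
    (c d : Set V × Set V) : Prop :=
  ∃ i j : Bool,
    ((¬ ∃ C, IsCompOf G C ((tildeSep G (pickSide c i ∩ pickSide d j)).1 \
        (tildeSep G (pickSide c i ∩ pickSide d j)).2) ∧
        tildeSep G (C ∪ Nbhd G C) ∈ 𝒞) ∨
     (¬ ∃ C, IsCompOf G C ((tildeSep G (pickSide c i ∩ pickSide d j)).2 \
        (tildeSep G (pickSide c i ∩ pickSide d j)).1) ∧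
        tildeSep G (C ∪ Nbhd G C) ∈ 𝒞)) ∧
    (c.1 ∩ c.2) ∪ (d.1 ∩ d.2) ⊆ pickSide c (!i) ∩ pickSide d (!j)

/-- A cut system is nested if each two of its cuts are nested. -/
def IsNestedSystem {V : Type u} (G : SimpleGraph V) (𝒞 : Set (Set V × Set V)) : Prop :=
  ∀ c ∈ 𝒞, ∀ d ∈ 𝒞, NestedPair G 𝒞 c d

/-- `S` is a `𝒞`-separator. -/
def IsSeparatorOf {V : Type u} (𝒞 : Set (Set V × Set V)) (S : Set V) : Prop :=
  ∃ c ∈ 𝒞, c.1 ∩ c.2 = S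

/-- A vertex set contains an end: some ray lies in it. -/
def ContainsEnd {V : Type u} (G : SimpleGraph V) (A : Set V) : Prop :=
  ∃ r : ℕ → V, IsRay G r ∧ ∀ n, r n ∈ A

/-- A basic cut system. -/
def IsBasic {V : Type u} (G : SimpleGraph V) (𝒞 : Set (Set V × Set V)) : Prop :=
  IsCutSystem G 𝒞 ∧
  (∀ c ∈ 𝒞, ∀ d ∈ 𝒞, ¬ sepOrder c < sepOrder d) ∧
  IsNestedSystem G 𝒞 ∧
  (∀ φ : G ≃g G, ∀ c ∈ 𝒞, ((⇑φ '' c.1, ⇑φ '' c.2) : Set V × Set V) ∈ 𝒞) ∧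
  (∀ S S' : Set V, IsSeparatorOf 𝒞 S → IsSeparatorOf 𝒞 S' → ∃ φ : G ≃g G, ⇑φ '' S = S') ∧
  (∀ c ∈ 𝒞, ContainsEnd G c.1 ∧ ContainsEnd G c.2 ∧
    ¬ ∃ d : Set V × Set V, IsSeparation G d ∧ (d.1 ∩ d.2).Finite ∧
      (d.1 ∩ d.2).ncard < sepOrder c ∧ ContainsEnd G d.1 ∧ ContainsEnd G d.2)

/-- The defining property of a `𝒞`-block. -/
def BlockProp {V : Type u} (𝒞 : Set (Set V × Set V)) (X : Set V) : Prop :=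
  (∀ c ∈ 𝒞, (X ⊆ c.1 ∨ X ⊆ c.2) ∧ ¬ (X ⊆ c.1 ∧ X ⊆ c.2)) ∧
  ∃ c ∈ 𝒞, X ⊆ c.1 ∧ c.1 ∩ c.2 ⊆ X

/-- A `𝒞`-block: a maximal vertex set with the block property. -/
def IsCBlock {V : Type u} (𝒞 : Set (Set V × Set V)) (X : Set V) : Prop :=
  BlockProp 𝒞 X ∧ ∀ X', X ⊆ X' → BlockProp 𝒞 X' → X' = X

/-- A digraph is C-homogeneous: every isomorphism between finite induced
subdigraphs with connected underlying graphs extends to an automorphism. -/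
def DigraphCHom {V : Type u} (E : V → V → Prop) : Prop :=
  ∀ (X Y : Set V), X.Finite → Y.Finite → ((UG E).induce X).Connected →
  ∀ φ : X ≃ Y, (∀ a b : X, E a.1 b.1 ↔ E (φ a).1 (φ b).1) →
  ∃ ψ : Equiv.Perm V, (∀ x y, E (ψ x) (ψ y) ↔ E x y) ∧ ∀ a : X, ψ a.1 = (φ a).1

/-- A graph is C-homogeneous: every isomorphism between finite connected induced
subgraphs extends to an automorphism. -/
def GraphCHom {V : Type u} (G : SimpleGraph V) : Prop :=
  ∀ (X Y : Set V), X.Finite → Y.Finite → (G.induce X).Connected →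
  ∀ φ : X ≃ Y, (∀ a b : X, G.Adj a.1 b.1 ↔ G.Adj (φ a).1 (φ b).1) →
  ∃ ψ : G ≃g G, ∀ a : X, ψ a.1 = (φ a).1

/-- The digraph contains a triangle: three pairwise adjacent vertices. -/
def HasTriangle {V : Type u} (E : V → V → Prop) : Prop :=
  ∃ x y z : V, (UG E).Adj x y ∧ (UG E).Adj y z ∧ (UG E).Adj x z

/-- An `n`-arc: a directed path `p 0, p 1, …, p n`. -/
def IsArc {V : Type u} (E : V → V → Prop) (n : ℕ) (p : ℕ → V) : Prop :=
  (∀ i j, i ≤ n → j ≤ n → p i = p j → i = j) ∧ ∀ i < n, E (p i) (p (i + 1))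

/-- A digraph is highly-arc-transitive: for every `n`, its automorphism group acts
transitively on `n`-arcs. -/
def HighlyArcTransitive {V : Type u} (E : V → V → Prop) : Prop :=
  ∀ n : ℕ, ∀ p q : ℕ → V, IsArc E n p → IsArc E n q →
  ∃ ψ : Equiv.Perm V, (∀ x y, E (ψ x) (ψ y) ↔ E x y) ∧ ∀ i ≤ n, ψ (p i) = q i

/-- An alternating walk `w 0, …, w n` in a digraph. -/
def IsAltWalk {V : Type u} (E : V → V → Prop) (n : ℕ) (w : ℕ → V) : Prop :=
  (∀ i < n, E (w i) (w (i + 1)) ∨ E (w (i + 1)) (w i)) ∧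
  ∀ i, i + 2 ≤ n → (E (w i) (w (i + 1)) ↔ E (w (i + 2)) (w (i + 1)))

/-- The edge `e` lies on the walk `w 0, …, w n` (in either direction). -/
def EdgeOnWalk {V : Type u} (n : ℕ) (w : ℕ → V) (e : V × V) : Prop :=
  ∃ i < n, (w i = e.1 ∧ w (i + 1) = e.2) ∨ (w i = e.2 ∧ w (i + 1) = e.1)

/-- Two edges are reachable from each other: they lie on a common alternating walk. -/
def Reach {V : Type u} (E : V → V → Prop) (e f : V × V) : Prop :=
  ∃ n w, IsAltWalk E n w ∧ EdgeOnWalk n w e ∧ EdgeOnWalk n w f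

/-- The edge relation of the reachability digraph `Δ_e`. -/
def DeltaRel {V : Type u} (E : V → V → Prop) (e : V × V) : V → V → Prop :=
  fun x y => E x y ∧ Reach E e (x, y)

/-- The underlying undirected graph of the reachability digraph `Δ_e`. -/
def DeltaGraph {V : Type u} (E : V → V → Prop) (e : V × V) : SimpleGraph V :=
  UG (DeltaRel E e)

/-- Tails of edges of `𝒜(e)`. -/
def Tails {V : Type u} (E : V → V → Prop) (e : V × V) : Set V :=
  {x | ∃ y, DeltaRel E e x y}

/-- Heads of edges of `𝒜(e)`. -/
def Heads {V : Type u} (E : V → V → Prop) (e : V × V) : Set V :=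
  {y | ∃ x, DeltaRel E e x y}

/-- The set of descendants of a vertex. -/
def Descendants {V : Type u} (E : V → V → Prop) (x : V) : Set V :=
  {y | ∃ n p, IsArc E n p ∧ p 0 = x ∧ p n = y}

/-- `(X, Y)` is a bipartition of the graph `G`. -/
def IsBipartition {V : Type u} (G : SimpleGraph V) (X Y : Set V) : Prop :=
  X ∪ Y = univ ∧ Disjoint X Y ∧
  ∀ a b, G.Adj a b → (a ∈ X ∧ b ∈ Y) ∨ (a ∈ Y ∧ b ∈ X)

/-- `G` with sides `X`, `Y` is C-homogeneous bipartite: every isomorphism between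
finite connected induced subgraphs preserving the sides extends to a side-preserving
automorphism. -/
def BipCHom {V : Type u} (G : SimpleGraph V) (X Y : Set V) : Prop :=
  ∀ (A B : Set V), A.Finite → B.Finite → (G.induce A).Connected →
  ∀ φ : A ≃ B, (∀ a b : A, G.Adj a.1 b.1 ↔ G.Adj (φ a).1 (φ b).1) →
  (∀ a : A, a.1 ∈ X ↔ (φ a).1 ∈ X) → (∀ a : A, a.1 ∈ Y ↔ (φ a).1 ∈ Y) →
  ∃ ψ : G ≃g G, (∀ v, v ∈ X ↔ ψ v ∈ X) ∧ (∀ v, v ∈ Y ↔ ψ v ∈ Y) ∧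
    ∀ a : A, ψ a.1 = (φ a).1

/-- `G` with sides `X`, `Y` is homogeneous bipartite: every isomorphism between
finite induced subgraphs preserving the sides extends to a side-preserving
automorphism. -/
def BipHom {V : Type u} (G : SimpleGraph V) (X Y : Set V) : Prop :=
  ∀ (A B : Set V), A.Finite → B.Finite →
  ∀ φ : A ≃ B, (∀ a b : A, G.Adj a.1 b.1 ↔ G.Adj (φ a).1 (φ b).1) →
  (∀ a : A, a.1 ∈ X ↔ (φ a).1 ∈ X) → (∀ a : A, a.1 ∈ Y ↔ (φ a).1 ∈ Y) →
  ∃ ψ : G ≃g G, (∀ v, v ∈ X ↔ ψ v ∈ X) ∧ (∀ v, v ∈ Y ↔ ψ v ∈ Y) ∧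
    ∀ a : A, ψ a.1 = (φ a).1

/-- `G` with sides `X`, `Y` is generic bipartite. -/
def GenericBip {V : Type u} (G : SimpleGraph V) (X Y : Set V) : Prop :=
  (∀ U W : Set V, U ⊆ X → W ⊆ X → U.Finite → W.Finite → Disjoint U W →
    ∃ v ∈ Y, (∀ u ∈ U, G.Adj v u) ∧ ∀ w ∈ W, ¬ G.Adj v w) ∧
  (∀ U W : Set V, U ⊆ Y → W ⊆ Y → U.Finite → W.Finite → Disjoint U W →
    ∃ v ∈ X, (∀ u ∈ U, G.Adj v u) ∧ ∀ w ∈ W, ¬ G.Adj v w)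

section Cuts

variable {V : Type u} {G : SimpleGraph V} {A B A' B' : Set V}

/-- A pair of vertex sets covering a graph with finite intersection, no edge between the two
complements, and rays on both sides. -/
structure EndCut (G : SimpleGraph V) (A B : Set V) : Prop where
  cover : ∀ v, v ∈ A ∨ v ∈ B
  noedge : ∀ x y, G.Adj x y → x ∉ B → y ∉ A → False
  fin : (A ∩ B).Finite
  left : ContainsEnd G A
  right : ContainsEnd G B

/-- An `EndCut` whose separator is as small as possible. -/
def MinCut (G : SimpleGraph V) (A B : Set V) : Prop :=
  EndCut G A B ∧ ∀ A' B', EndCut G A' B' → (A ∩ B).ncard ≤ (A' ∩ B').ncard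

theorem EndCut.symm (h : EndCut G A B) : EndCut G B A :=
  ⟨fun v => (h.cover v).symm, fun x y hxy hx hy => h.noedge y x hxy.symm hy hx,
    by rw [inter_comm]; exact h.fin, h.right, h.left⟩

theorem MinCut.symm (h : MinCut G A B) : MinCut G B A :=
  ⟨h.1.symm, by rw [inter_comm]; exact h.2⟩

theorem ContainsEnd.mono {U W : Set V} (h : ContainsEnd G U) (hUW : U ⊆ W) : ContainsEnd G W :=
  let ⟨r, hr, hrU⟩ := h
  ⟨r, hr, fun n => hUW (hrU n)⟩

theorem IsRay.shift {r : ℕ → V} (h : IsRay G r) (N : ℕ) : IsRay G (fun n => r (N + n)) :=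
  ⟨fun a b hab => by simpa using h.1 hab, fun n => h.2 (N + n)⟩

theorem IsRay.exists_avoid {r : ℕ → V} (h : IsRay G r) {F : Set V} (hF : F.Finite) :
    ∃ N, ∀ n, N ≤ n → r n ∉ F := by
  have hfin : (r ⁻¹' F).Finite := hF.preimage h.1.injOn
  obtain ⟨N, hN⟩ := hfin.bddAbove
  exact ⟨N + 1, fun n hn hr => absurd (hN hr) (by omega)⟩

theorem ContainsEnd.diff {U F : Set V} (h : ContainsEnd G U) (hF : F.Finite) :
    ContainsEnd G (U \ F) := by
  obtain ⟨r, hr, hU⟩ := h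
  obtain ⟨N, hN⟩ := IsRay.exists_avoid hr hF
  exact ⟨_, IsRay.shift hr N, fun n => ⟨hU _, hN _ (by omega)⟩⟩

theorem EndCut.containsEnd_or (h : EndCut G A B) {U : Set V} (hU : ContainsEnd G U) :
    ContainsEnd G (U ∩ A) ∨ ContainsEnd G (U ∩ B) := by
  obtain ⟨r, hr, hrU⟩ := hU.diff h.fin
  by_cases hB : ∀ n, r n ∈ B
  · exact Or.inr ⟨r, hr, fun n => ⟨(hrU n).1, hB n⟩⟩
  · push Not at hB
    obtain ⟨N, hN⟩ := hB
    have key : ∀ n, r (N + n) ∉ B := by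
      intro n
      induction n with
      | zero => exact hN
      | succ n ih =>
        intro hB'
        have hA : r (N + n + 1) ∈ A := by
          by_contra hA
          exact h.noedge _ _ (hr.2 (N + n)) ih hA
        exact (hrU _).2 ⟨hA, hB'⟩
    exact Or.inl ⟨_, IsRay.shift hr N, fun n =>
      ⟨(hrU _).1, (h.cover _).resolve_right (key n)⟩⟩

theorem EndCut.corners (h : EndCut G A B) (h' : EndCut G A' B') :
    (ContainsEnd G (A ∩ A') ∧ ContainsEnd G (B ∩ B')) ∨
      (ContainsEnd G (A ∩ B') ∧ ContainsEnd G (B ∩ A')) := by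
  have h1 := h'.containsEnd_or h.left
  have h2 := h'.containsEnd_or h.right
  have h3 := h.containsEnd_or h'.left
  have h4 := h.containsEnd_or h'.right
  rw [inter_comm A' A, inter_comm A' B] at h3
  rw [inter_comm B' A, inter_comm B' B] at h4
  tauto

theorem EndCut.union (h : EndCut G A B) (h' : EndCut G A' B') (hB : ContainsEnd G (B ∩ B')) :
    EndCut G (A ∪ A') (B ∩ B') where
  cover v := by
    have := h.cover v
    have := h'.cover v
    simp only [mem_union, mem_inter_iff]
    tauto
  noedge x y hxy hx hy := by
    have := h.noedge x y hxy
    have := h'.noedge x y hxy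
    simp only [mem_union, mem_inter_iff] at hx hy
    tauto
  fin := (h.fin.union h'.fin).subset (by
    intro v hv
    simp only [mem_union, mem_inter_iff] at hv ⊢
    tauto)
  left := h.left.mono subset_union_left
  right := hB

theorem MinCut.uncross (h : MinCut G A B) (h' : MinCut G A' B')
    (hA : ContainsEnd G (A ∩ A')) (hB : ContainsEnd G (B ∩ B')) :
    MinCut G (A ∪ A') (B ∩ B') ∧ MinCut G (A ∩ A') (B ∪ B') := by
  have c1 : EndCut G (A ∪ A') (B ∩ B') := h.1.union h'.1 hB
  have c2 : EndCut G (A ∩ A') (B ∪ B') := (h.1.symm.union h'.1.symm hA).symm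
  have e1 := h.2 _ _ c1
  have e2 := h.2 _ _ c2
  have e3 := h.2 _ _ h'.1
  have e4 := h'.2 _ _ h.1
  have s1 := ncard_union_add_ncard_inter _ _ c1.fin c2.fin
  have s2 := ncard_union_add_ncard_inter _ _ h.1.fin h'.1.fin
  have s3 : (((A ∪ A') ∩ (B ∩ B')) ∪ ((A ∩ A') ∩ (B ∪ B'))).ncard ≤
      ((A ∩ B) ∪ (A' ∩ B')).ncard := by
    refine ncard_le_ncard ?_ (h.1.fin.union h'.1.fin)
    intro v hv
    simp only [mem_union, mem_inter_iff] at hv ⊢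
    tauto
  have s4 : (((A ∪ A') ∩ (B ∩ B')) ∩ ((A ∩ A') ∩ (B ∪ B'))).ncard ≤
      ((A ∩ B) ∩ (A' ∩ B')).ncard := by
    refine ncard_le_ncard ?_ (h.1.fin.inter_of_left _)
    intro v hv
    simp only [mem_union, mem_inter_iff] at hv ⊢
    tauto
  refine ⟨⟨c1, fun P Q hPQ => ?_⟩, ⟨c2, fun P Q hPQ => ?_⟩⟩
  · have := h.2 _ _ hPQ
    omega
  · have := h.2 _ _ hPQ
    omega

theorem MinCut.exists_adj_not_mem_left (h : MinCut G A B) {s : V} (hs : s ∈ A ∩ B) :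
    ∃ y, y ∉ A ∧ G.Adj s y := by
  by_contra hcon
  push Not at hcon
  have hsep : (A ∩ B) \ {s} ⊂ A ∩ B := by
    refine ⟨sdiff_subset, fun hsub => ?_⟩
    exact (hsub hs).2 rfl
  have hAB : A ∩ (B \ {s}) = (A ∩ B) \ {s} := (inter_sdiff_assoc ..).symm
  have cut : EndCut G A (B \ {s}) := by
    refine ⟨fun v => ?_, fun x y hxy hx hy => ?_, ?_, h.1.left, h.1.right.diff (finite_singleton s)⟩
    · by_cases hv : v = s
      · exact Or.inl (hv ▸ hs.1)
      · exact (h.1.cover v).imp id (fun hb => ⟨hb, hv⟩)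
    · by_cases hxs : x = s
      · exact hcon y hy (hxs ▸ hxy)
      · exact h.1.noedge x y hxy (fun hb => hx ⟨hb, hxs⟩) hy
    · exact h.1.fin.subset (inter_subset_inter_right _ sdiff_subset)
  have h1 := h.2 _ _ cut
  rw [hAB] at h1
  exact absurd (ncard_lt_ncard hsep h.1.fin) (by omega)

theorem EndCut.preimage (h : EndCut G A B) (ψ : G ≃g G) : EndCut G (ψ ⁻¹' A) (ψ ⁻¹' B) where
  cover v := h.cover (ψ v)
  noedge x y hxy hx hy := h.noedge (ψ x) (ψ y) (ψ.map_adj_iff.2 hxy) hx hy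
  fin := by
    rw [← preimage_inter]
    exact h.fin.preimage ψ.injective.injOn
  left := by
    obtain ⟨r, hr, hrA⟩ := h.left
    refine ⟨fun n => ψ.symm (r n), ⟨ψ.symm.injective.comp hr.1, fun n => ?_⟩, fun n => ?_⟩
    · exact ψ.symm.map_adj_iff.2 (hr.2 n)
    · simpa using hrA n
  right := by
    obtain ⟨r, hr, hrA⟩ := h.right
    refine ⟨fun n => ψ.symm (r n), ⟨ψ.symm.injective.comp hr.1, fun n => ?_⟩, fun n => ?_⟩
    · exact ψ.symm.map_adj_iff.2 (hr.2 n)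
    · simpa using hrA n

theorem MinCut.preimage (h : MinCut G A B) (ψ : G ≃g G) : MinCut G (ψ ⁻¹' A) (ψ ⁻¹' B) := by
  refine ⟨h.1.preimage ψ, fun P Q hPQ => ?_⟩
  have e : (ψ ⁻¹' A ∩ ψ ⁻¹' B).ncard = (A ∩ B).ncard := by
    rw [← preimage_inter]
    exact ncard_preimage_of_injective_subset_range ψ.injective (by simp [ψ.surjective.range_eq])
  rw [e]
  exact h.2 _ _ hPQ

theorem exists_minCut_of_endCut (h : EndCut G A B) : ∃ A B, MinCut G A B := by
  classical
  have hex : ∃ n A B, EndCut G A B ∧ (A ∩ B).ncard = n := ⟨_, A, B, h, rfl⟩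
  obtain ⟨A, B, hAB, hn⟩ := Nat.find_spec hex
  exact ⟨A, B, hAB, fun A' B' h' => hn ▸ Nat.find_min' hex ⟨A', B', h', rfl⟩⟩

end Cuts

section Existence

variable {V : Type u} {G : SimpleGraph V} {A B : Set V}

theorem SimpleGraph.Reachable.mem_of_closed {W : Type*} {H : SimpleGraph W} {a b : W}
    (h : H.Reachable a b) {U : Set W} (ha : a ∈ U) (hU : ∀ x y, H.Adj x y → x ∈ U → y ∈ U) :
    b ∈ U := by
  obtain ⟨p⟩ := h
  induction p with
  | nil => exact ha
  | cons hxy _ ih => exact ih (hU _ _ hxy ha)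

theorem SimpleGraph.Connected.subset_of_closed {X : Set V} (h : (G.induce X).Connected)
    {U : Set V} {a : V} (haX : a ∈ X) (ha : a ∈ U)
    (hU : ∀ x y, x ∈ X → y ∈ X → G.Adj x y → x ∈ U → y ∈ U) : X ⊆ U := by
  intro b hb
  exact (h.preconnected ⟨a, haX⟩ ⟨b, hb⟩).mem_of_closed (U := Subtype.val ⁻¹' U) ha
    (fun x y hxy => hU x y x.2 y.2 hxy)

theorem SimpleGraph.connected_induce_of_forall_reachable {X : Set V} {a : V} (ha : a ∈ X)
    (h : ∀ U : Set V, a ∈ U → (∀ x y, x ∈ X → y ∈ X → G.Adj x y → x ∈ U → y ∈ U) → X ⊆ U) :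
    (G.induce X).Connected := by
  rw [SimpleGraph.connected_iff_exists_forall_reachable]
  refine ⟨⟨a, ha⟩, fun ⟨b, hb⟩ => ?_⟩
  obtain ⟨hb', h'⟩ := h {v | ∃ hv : v ∈ X, (G.induce X).Reachable ⟨a, ha⟩ ⟨v, hv⟩}
    ⟨ha, SimpleGraph.Reachable.refl _⟩
    (fun x y _ hy hxy ⟨hx', hr⟩ => ⟨hy, hr.trans (SimpleGraph.Adj.reachable
      (show (G.induce X).Adj ⟨x, hx'⟩ ⟨y, hy⟩ from hxy))⟩) hb
  exact h'

theorem exists_endCut (h : MoreThanOneEnd G) : ∃ A B, EndCut G A B := by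
  obtain ⟨r, r', hr, hr', hne⟩ := h
  unfold RayEquiv at hne
  push Not at hne
  obtain ⟨S, hS⟩ := hne
  obtain ⟨N, hN⟩ := IsRay.exists_avoid hr S.finite_toSet
  obtain ⟨M, hM⟩ := IsRay.exists_avoid hr' S.finite_toSet
  have hN' : ∀ n, N ≤ n → r n ∉ S := hN
  have hM' : ∀ n, M ≤ n → r' n ∉ S := hM
  set C : Set V := {v | Relation.ReflTransGen (fun a b => G.Adj a b ∧ b ∉ S) (r N) v} with hC
  have hstep : ∀ a b, a ∈ C → G.Adj a b → b ∉ S → b ∈ C :=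
    fun a b ha hab hb => Relation.ReflTransGen.tail ha ⟨hab, hb⟩
  have h0 : r N ∈ C := Relation.ReflTransGen.refl
  have hCS : C ⊆ {v | v ∉ S} := by
    intro v hv
    rcases Relation.ReflTransGen.cases_tail hv with h | ⟨_, _, h⟩
    · subst h
      exact hN' N le_rfl
    · exact h.2
  have hcomp : IsCompOf G C {v | v ∉ S} := by
    refine ⟨⟨_, h0⟩, hCS, ?_, fun C' hCC' hC'S hC' => ?_⟩
    · refine SimpleGraph.connected_induce_of_forall_reachable h0 (fun U hU hcl v hv => ?_)
      have : v ∈ C ∩ U := by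
        induction hv with
        | refl => exact ⟨h0, hU⟩
        | tail _ hbc ih => exact ⟨hstep _ _ ih.1 hbc.1 hbc.2,
            hcl _ _ ih.1 (hstep _ _ ih.1 hbc.1 hbc.2) hbc.1 ih.2⟩
      exact this.2
    · refine Subset.antisymm ?_ hCC'
      exact hC'.subset_of_closed (hCC' h0) h0 (fun x y _ hy hxy hx => hstep x y hx hxy (hC'S hy))
  have hrC : ∀ n, r (N + n) ∈ C := by
    intro n
    induction n with
    | zero => exact h0
    | succ n ih => exact hstep _ _ ih (hr.2 _) (hN' _ (by omega))
  have hr'C : ∀ n, r' (M + n) ∉ C := by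
    intro n hn
    refine hS C hcomp ⟨N, fun k hk => ?_⟩ ⟨M + n, fun k hk => ?_⟩
    · obtain ⟨j, rfl⟩ := Nat.exists_eq_add_of_le hk
      exact hrC j
    · obtain ⟨j, rfl⟩ := Nat.exists_eq_add_of_le hk
      induction j with
      | zero => exact hn
      | succ j ih => exact hstep _ _ (ih (by omega)) (hr'.2 _) (hM' _ (by omega))
  refine ⟨C ∪ ↑S, Cᶜ, ?_, ?_, ?_, ?_, ?_⟩
  · intro v
    by_cases hv : v ∈ C
    · exact Or.inl (Or.inl hv)
    · exact Or.inr hv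
  · intro x y hxy hx hy
    rw [mem_union, not_or] at hy
    exact hy.1 (hstep x y (not_not.1 hx) hxy hy.2)
  · refine S.finite_toSet.subset ?_
    rintro v ⟨h1 | h1, h2⟩
    · exact absurd h1 h2
    · exact h1
  · exact ⟨_, IsRay.shift hr N, fun n => Or.inl (hrC n)⟩
  · exact ⟨_, IsRay.shift hr' M, hr'C⟩

theorem exists_minCut (h : MoreThanOneEnd G) : ∃ A B, MinCut G A B :=
  let ⟨_, _, hAB⟩ := exists_endCut h
  exists_minCut_of_endCut hAB

theorem EndCut.inter_nonempty (h : EndCut G A B) (hG : G.Connected) : (A ∩ B).Nonempty := by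
  by_contra hne
  rw [not_nonempty_iff_eq_empty] at hne
  obtain ⟨r, -, hr⟩ := h.left
  obtain ⟨r', -, hr'⟩ := h.right
  have : r' 0 ∈ A := by
    refine (hG.preconnected (r 0) (r' 0)).mem_of_closed (hr 0) (fun x y hxy hx => ?_)
    by_contra hy
    refine h.noedge x y hxy (fun hxB => ?_) hy
    exact (eq_empty_iff_forall_notMem.1 hne) x ⟨hx, hxB⟩
  exact (eq_empty_iff_forall_notMem.1 hne) _ ⟨this, hr' 0⟩

theorem EndCut.not_mem_right (h : EndCut G A B) {v : V} (hv : v ∉ B) : v ∈ A :=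
  (h.cover v).resolve_right hv

theorem EndCut.not_mem_left (h : EndCut G A B) {v : V} (hv : v ∉ A) : v ∈ B :=
  (h.cover v).resolve_left hv

end Existence

section Homogeneous

variable {V : Type u} {G : SimpleGraph V} {E : V → V → Prop} {A B : Set V}

/-- A relation whose symmetrization is a connected graph, homogeneous with respect to connected
finite subsets, and in which every in- and out-neighbourhood meets the closed neighbourhood of
each neighbour. It is either symmetric or antisymmetric. -/
structure ConnHom (G : SimpleGraph V) (E : V → V → Prop) : Prop where
  adj : ∀ a b, G.Adj a b ↔ E a b ∨ E b a
  symm_or : (∀ x y, E x y → E y x) ∨ (∀ x y, E x y → ¬ E y x)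
  extend : ∀ X : Set V, X.Finite → (G.induce X).Connected → ∀ f : V → V, InjOn f X →
    (∀ a ∈ X, ∀ b ∈ X, E (f a) (f b) ↔ E a b) →
    ∃ ψ : G ≃g G, (∀ x y, E (ψ x) (ψ y) ↔ E x y) ∧ ∀ a ∈ X, ψ a = f a
  near_out : ∀ s y, G.Adj s y → ∃ z, E s z ∧ (z = y ∨ G.Adj z y)
  near_in : ∀ s y, G.Adj s y → ∃ z, E z s ∧ (z = y ∨ G.Adj z y)
  conn : G.Connected

namespace ConnHom

theorem flip (h : ConnHom G E) : ConnHom G (fun x y => E y x) where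
  adj a b := (h.adj a b).trans or_comm
  symm_or := h.symm_or.imp (fun H x y => H y x) (fun H x y => H y x)
  extend X hX hc f hf hE := by
    obtain ⟨ψ, h1, h2⟩ := h.extend X hX hc f hf (fun a ha b hb => hE b hb a ha)
    exact ⟨ψ, fun x y => h1 y x, h2⟩
  near_out := h.near_in
  near_in := h.near_out
  conn := h.conn

theorem adj_out (h : ConnHom G E) {a b : V} (hab : E a b) : G.Adj a b := (h.adj a b).2 (Or.inl hab)

theorem adj_in (h : ConnHom G E) {a b : V} (hab : E b a) : G.Adj a b := (h.adj a b).2 (Or.inr hab)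

theorem extend_family (h : ConnHom G E) {ι : Type} [Finite ι] (b b' : ι → V)
    (hb : Function.Injective b) (hb' : Function.Injective b')
    (hc : (G.induce (range b)).Connected) (hE : ∀ i j, E (b' i) (b' j) ↔ E (b i) (b j)) :
    ∃ ψ : G ≃g G, (∀ x y, E (ψ x) (ψ y) ↔ E x y) ∧ ∀ i, ψ (b i) = b' i := by
  have key : ∀ i, Function.extend b b' id (b i) = b' i := fun i => hb.extend_apply b' id i
  obtain ⟨ψ, h1, h2⟩ := h.extend (range b) (finite_range b) hc (Function.extend b b' id) (by
    rintro _ ⟨i, rfl⟩ _ ⟨j, rfl⟩ hij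
    rw [key, key] at hij
    rw [hb' hij]) (by
    rintro _ ⟨i, rfl⟩ _ ⟨j, rfl⟩
    rw [key, key]
    exact hE i j)
  exact ⟨ψ, h1, fun i => (h2 _ ⟨i, rfl⟩).trans (key i)⟩

/-- The edges `s a` and `s' a'` have the same direction seen from `s` and `s'`. -/
def SameType (E : V → V → Prop) (s a s' a' : V) : Prop :=
  (E s a ∧ E s' a') ∨ (E a s ∧ E a' s')

theorem extend_star (h : ConnHom G E) {κ : Type} [Finite κ] (s s' : V) (a a' : κ → V)
    (hty : ∀ i, SameType E s (a i) s' (a' i))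
    (ha : ∀ i j, i ≠ j → a i ≠ a j ∧ ¬ G.Adj (a i) (a j))
    (ha' : ∀ i j, i ≠ j → a' i ≠ a' j ∧ ¬ G.Adj (a' i) (a' j)) :
    ∃ ψ : G ≃g G, (∀ x y, E (ψ x) (ψ y) ↔ E x y) ∧ ψ s = s' ∧ ∀ i, ψ (a i) = a' i := by
  have hadj : ∀ i, G.Adj s (a i) := fun i => (h.adj _ _).2 ((hty i).imp And.left And.left)
  have hadj' : ∀ i, G.Adj s' (a' i) := fun i => (h.adj _ _).2 ((hty i).imp And.right And.right)
  have hirr : ∀ x, ¬ E x x := fun x hx => (h.adj_out hx).ne rfl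
  have hno : ∀ i j, ¬ E (a i) (a j) := by
    intro i j hij
    by_cases e : i = j
    · exact hirr _ (e ▸ hij)
    · exact (ha i j e).2 (h.adj_out hij)
  have hno' : ∀ i j, ¬ E (a' i) (a' j) := by
    intro i j hij
    by_cases e : i = j
    · exact hirr _ (e ▸ hij)
    · exact (ha' i j e).2 (h.adj_out hij)
  have inj : ∀ (t : V) (c : κ → V), (∀ i, G.Adj t (c i)) →
      (∀ i j, i ≠ j → c i ≠ c j ∧ ¬ G.Adj (c i) (c j)) →
      Function.Injective (fun o : Option κ => o.elim t c) := by
    intro t c h1 h2 o o' hoo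
    cases o with
    | none =>
      cases o' with
      | none => rfl
      | some j => exact absurd hoo (h1 j).ne
    | some i =>
      cases o' with
      | none => exact absurd hoo (h1 i).ne'
      | some j =>
        by_contra hij
        exact (h2 i j (fun e => hij (e ▸ rfl))).1 hoo
  obtain ⟨ψ, h1, h2⟩ := h.extend_family (fun o : Option κ => o.elim s a)
    (fun o : Option κ => o.elim s' a') (inj s a hadj ha) (inj s' a' hadj' ha') (by
      refine SimpleGraph.connected_induce_of_forall_reachable (a := s) ⟨none, rfl⟩
        (fun U hU hcl => ?_)
      rintro _ ⟨o, rfl⟩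
      cases o with
      | none => exact hU
      | some i => exact hcl s (a i) ⟨none, rfl⟩ ⟨some i, rfl⟩ (hadj i) hU) (by
      intro o o'
      cases o with
      | none =>
        cases o' with
        | none => exact iff_of_false (hirr _) (hirr _)
        | some j =>
          rcases hty j with ⟨e, e'⟩ | ⟨e, e'⟩
          · exact iff_of_true e' e
          · rcases h.symm_or with hs | hs
            · exact iff_of_true (hs _ _ e') (hs _ _ e)
            · exact iff_of_false (hs _ _ e') (hs _ _ e)
      | some i =>
        cases o' with
        | none =>
          rcases hty i with ⟨e, e'⟩ | ⟨e, e'⟩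
          · rcases h.symm_or with hs | hs
            · exact iff_of_true (hs _ _ e') (hs _ _ e)
            · exact iff_of_false (hs _ _ e') (hs _ _ e)
          · exact iff_of_true e' e
        | some j => exact iff_of_false (hno' i j) (hno i j))
  exact ⟨ψ, h1, h2 none, fun i => h2 (some i)⟩

theorem vertex_transitive (h : ConnHom G E) (s s' : V) :
    ∃ ψ : G ≃g G, (∀ x y, E (ψ x) (ψ y) ↔ E x y) ∧ ψ s = s' := by
  obtain ⟨ψ, h1, h2, -⟩ := h.extend_star (κ := Empty) s s' Empty.elim Empty.elim
    (fun i => i.elim) (fun i => i.elim) (fun i => i.elim)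
  exact ⟨ψ, h1, h2⟩

theorem edge_transitive (h : ConnHom G E) {s a s' a' : V} (hty : SameType E s a s' a') :
    ∃ ψ : G ≃g G, (∀ x y, E (ψ x) (ψ y) ↔ E x y) ∧ ψ s = s' ∧ ψ a = a' := by
  obtain ⟨ψ, h1, h2, h3⟩ := h.extend_star (κ := Unit) s s' (fun _ => a) (fun _ => a')
    (fun _ => hty) (fun i j hij => (hij rfl).elim) (fun i j hij => (hij rfl).elim)
  exact ⟨ψ, h1, h2, h3 ()⟩

theorem pair_transitive (h : ConnHom G E) {s a b s' a' b' : V} (hta : SameType E s a s' a')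
    (htb : SameType E s b s' b') (hab : a ≠ b ∧ ¬ G.Adj a b) (hab' : a' ≠ b' ∧ ¬ G.Adj a' b') :
    ∃ ψ : G ≃g G, (∀ x y, E (ψ x) (ψ y) ↔ E x y) ∧ ψ s = s' ∧ ψ a = a' ∧ ψ b = b' := by
  have hba : b ≠ a ∧ ¬ G.Adj b a := ⟨hab.1.symm, fun e => hab.2 e.symm⟩
  have hba' : b' ≠ a' ∧ ¬ G.Adj b' a' := ⟨hab'.1.symm, fun e => hab'.2 e.symm⟩
  obtain ⟨ψ, h1, h2, h3⟩ := h.extend_star (κ := Fin 2) s s' ![a, b] ![a', b']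
    (by intro i; fin_cases i <;> assumption)
    (by intro i j hij; fin_cases i <;> fin_cases j <;> first | exact (hij rfl).elim | assumption)
    (by intro i j hij; fin_cases i <;> fin_cases j <;> first | exact (hij rfl).elim | assumption)
  exact ⟨ψ, h1, h2, h3 0, h3 1⟩

theorem triple_transitive (h : ConnHom G E) {s a b c s' a' b' c' : V}
    (hta : SameType E s a s' a') (htb : SameType E s b s' b') (htc : SameType E s c s' c')
    (hab : a ≠ b ∧ ¬ G.Adj a b) (hac : a ≠ c ∧ ¬ G.Adj a c) (hbc : b ≠ c ∧ ¬ G.Adj b c)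
    (hab' : a' ≠ b' ∧ ¬ G.Adj a' b') (hac' : a' ≠ c' ∧ ¬ G.Adj a' c')
    (hbc' : b' ≠ c' ∧ ¬ G.Adj b' c') :
    ∃ ψ : G ≃g G, (∀ x y, E (ψ x) (ψ y) ↔ E x y) ∧ ψ s = s' ∧ ψ a = a' ∧ ψ b = b' ∧
      ψ c = c' := by
  have sy : ∀ {x y : V}, x ≠ y ∧ ¬ G.Adj x y → y ≠ x ∧ ¬ G.Adj y x :=
    fun hxy => ⟨hxy.1.symm, fun e => hxy.2 e.symm⟩
  have hba := sy hab
  have hca := sy hac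
  have hcb := sy hbc
  have hba' := sy hab'
  have hca' := sy hac'
  have hcb' := sy hbc'
  obtain ⟨ψ, h1, h2, h3⟩ := h.extend_star (κ := Fin 3) s s' ![a, b, c] ![a', b', c']
    (by intro i; fin_cases i <;> assumption)
    (by intro i j hij; fin_cases i <;> fin_cases j <;> first | exact (hij rfl).elim | assumption)
    (by intro i j hij; fin_cases i <;> fin_cases j <;> first | exact (hij rfl).elim | assumption)
  exact ⟨ψ, h1, h2, h3 0, h3 1, h3 2⟩

theorem exists_minCut_mem (h : ConnHom G E) (hm : ∃ A B, MinCut G A B) (s : V) :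
    ∃ A B, MinCut G A B ∧ s ∈ A ∩ B := by
  obtain ⟨A, B, hAB⟩ := hm
  obtain ⟨t, ht⟩ := hAB.1.inter_nonempty h.conn
  obtain ⟨ψ, -, hψ⟩ := h.vertex_transitive s t
  refine ⟨_, _, hAB.preimage ψ, ?_⟩
  rw [← preimage_inter, mem_preimage, hψ]
  exact ht

theorem exists_minCut_edge (h : ConnHom G E)
    (hm : ∃ A B, MinCut G A B ∧ ∃ x y, x ∈ A ∩ B ∧ y ∈ A ∩ B ∧ G.Adj x y) {s t : V}
    (hst : G.Adj s t) : ∃ A B, MinCut G A B ∧ s ∈ A ∩ B ∧ t ∈ A ∩ B := by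
  obtain ⟨A, B, hAB, x, y, hx, hy, hxy⟩ := hm
  have key : ∀ {x y s t : V}, x ∈ A ∩ B → y ∈ A ∩ B → E x y → E s t →
      ∃ A B, MinCut G A B ∧ s ∈ A ∩ B ∧ t ∈ A ∩ B := by
    intro x y s t hx hy hxy hst
    obtain ⟨ψ, -, h1, h2⟩ := h.edge_transitive (Or.inl ⟨hst, hxy⟩)
    refine ⟨_, _, hAB.preimage ψ, ?_, ?_⟩
    · rw [← preimage_inter, mem_preimage, h1]
      exact hx
    · rw [← preimage_inter, mem_preimage, h2]
      exact hy
  have key' : ∀ {s t : V}, E s t → ∃ A B, MinCut G A B ∧ s ∈ A ∩ B ∧ t ∈ A ∩ B := by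
    intro s t hst
    rcases (h.adj x y).1 hxy with e | e
    · exact key hx hy e hst
    · exact key hy hx e hst
  rcases (h.adj s t).1 hst with e | e
  · exact key' e
  · obtain ⟨A, B, h1, h2, h3⟩ := key' e
    exact ⟨A, B, h1, h3, h2⟩

end ConnHom

end Homogeneous

section Spread

variable {V : Type u} {G : SimpleGraph V} {E : V → V → Prop} {A B : Set V}

/-- A sequence of pairwise non-adjacent out-neighbours of `s`, each of which has only finitely
many common neighbours with the union of the later ones. -/
def OutSpread (G : SimpleGraph V) (E : V → V → Prop) (s : V) (y : ℕ → V) : Prop :=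
  (∀ i, E s (y i)) ∧ ∀ i, ∃ S : Set V, S.Finite ∧ ∀ j, i < j →
    y i ≠ y j ∧ ¬ G.Adj (y i) (y j) ∧ ∀ u, G.Adj u (y i) → G.Adj u (y j) → u ∈ S

/-- Vertices lying in a common minimal separator whenever adjacent. -/
def EdgeCut (G : SimpleGraph V) : Prop :=
  ∀ s t, G.Adj s t → ∃ A B, MinCut G A B ∧ s ∈ A ∩ B ∧ t ∈ A ∩ B

theorem EdgeCut.exists_larger (he : EdgeCut G) (hc : MinCut G A B) {s y : V} (hs : s ∈ A ∩ B)
    (hy : y ∉ A) (hsy : G.Adj s y) :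
    ∃ A' B', MinCut G A' B' ∧ A ⊆ A' ∧ B' ⊆ B ∧ s ∈ A' ∩ B' ∧ y ∈ A' ∩ B' := by
  obtain ⟨P, Q, hPQ, hs', hy'⟩ := he s y hsy
  have hyB := hc.1.not_mem_left hy
  rcases hc.1.corners hPQ.1 with ⟨h1, h2⟩ | ⟨h1, h2⟩
  · exact ⟨_, _, (hc.uncross hPQ h1 h2).1, subset_union_left, inter_subset_left,
      ⟨Or.inl hs.1, hs.2, hs'.2⟩, ⟨Or.inr hy'.1, hyB, hy'.2⟩⟩
  · exact ⟨_, _, (hc.uncross hPQ.symm h1 h2).1, subset_union_left, inter_subset_left,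
      ⟨Or.inl hs.1, hs.2, hs'.1⟩, ⟨Or.inr hy'.2, hyB, hy'.1⟩⟩

/-- `(A, B)` is a minimal cut with `s` in its separator, at least as far to the left as
`(A₀, B₀)`. -/
def CutAbove (G : SimpleGraph V) (A₀ B₀ : Set V) (s : V) (p : Set V × Set V) : Prop :=
  MinCut G p.1 p.2 ∧ A₀ ⊆ p.1 ∧ p.2 ⊆ B₀ ∧ s ∈ p.1 ∩ p.2

theorem CutAbove.trans {A₀ B₀ : Set V} {s : V} {p q : Set V × Set V}
    (hp : CutAbove G A₀ B₀ s p) (hq : CutAbove G p.1 p.2 s q) : CutAbove G A₀ B₀ s q :=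
  ⟨hq.1, hp.2.1.trans hq.2.1, hq.2.2.1.trans hp.2.2.1, hq.2.2.2⟩

theorem EdgeCut.exists_step (he : EdgeCut G) (hE : ∀ a b, E a b → G.Adj a b) {A₀ B₀ : Set V}
    {s : V} (hout : ∀ p, CutAbove G A₀ B₀ s p → ∃ y, y ∉ p.1 ∧ E s y) {p : Set V × Set V}
    (hp : CutAbove G A₀ B₀ s p) :
    ∃ q y, CutAbove G p.1 p.2 s q ∧ E s y ∧ y ∉ p.1 ∧ y ∈ q.1 ∧ y ∉ q.2 := by
  by_contra hcon
  push Not at hcon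
  have key : ∀ n, ∃ q, CutAbove G p.1 p.2 s q ∧ n ≤ {y | E s y ∧ y ∉ p.1 ∧ y ∈ q.1}.ncard := by
    intro n
    induction n with
    | zero => exact ⟨p, ⟨hp.1, subset_rfl, subset_rfl, hp.2.2.2⟩, Nat.zero_le _⟩
    | succ n ih =>
      obtain ⟨q, hq, hn⟩ := ih
      obtain ⟨y, hyq, hsy⟩ := hout q (hp.trans hq)
      obtain ⟨A', B', hc', hA, hB, hs', hy'⟩ := he.exists_larger hq.1 hq.2.2.2 hyq (hE _ _ hsy)
      have hq' : CutAbove G q.1 q.2 s (A', B') := ⟨hc', hA, hB, hs'⟩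
      have hq'' := hq.trans hq'
      refine ⟨(A', B'), hq'', lt_of_le_of_lt hn (ncard_lt_ncard ⟨?_, ?_⟩ ?_)⟩
      · exact fun z hz => ⟨hz.1, hz.2.1, hA hz.2.2⟩
      · intro hsub
        exact hyq (hsub (show y ∈ _ from ⟨hsy, fun e => hyq (hq.2.1 e), hy'.1⟩)).2.2
      · exact hc'.1.fin.subset (fun z hz => ⟨hz.2.2, hcon _ z hq'' hz.1 hz.2.1 hz.2.2⟩)
  obtain ⟨q, hq, hn⟩ := key ((p.1 ∩ p.2).ncard + 1)
  have h1 : {y | E s y ∧ y ∉ p.1 ∧ y ∈ q.1}.ncard ≤ (q.1 ∩ q.2).ncard :=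
    ncard_le_ncard (fun z hz => ⟨hz.2.2, hcon q z hq hz.1 hz.2.1 hz.2.2⟩) hq.1.1.fin
  have h2 := hq.1.2 _ _ hp.1.1
  omega

theorem EdgeCut.exists_outSpread (he : EdgeCut G) (hE : ∀ a b, E a b → G.Adj a b) {s : V}
    (hc : MinCut G A B) (hs : s ∈ A ∩ B)
    (hout : ∀ p, CutAbove G A B s p → ∃ y, y ∉ p.1 ∧ E s y) :
    ∃ y, OutSpread G E s y ∧ ∀ i, y i ∉ A := by
  have hstep : ∀ p : {p // CutAbove G A B s p}, ∃ q : {p // CutAbove G A B s p}, ∃ y,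
      CutAbove G p.1.1 p.1.2 s q.1 ∧ E s y ∧ y ∉ p.1.1 ∧ y ∈ q.1.1 ∧ y ∉ q.1.2 := by
    rintro ⟨p, hp⟩
    obtain ⟨q, y, h1, h2⟩ := he.exists_step hE hout hp
    exact ⟨⟨q, hp.trans h1⟩, y, h1, h2⟩
  choose next y h1 h2 h3 h4 h5 using hstep
  let c : ℕ → {p // CutAbove G A B s p} :=
    fun n => Nat.rec ⟨(A, B), hc, subset_rfl, subset_rfl, hs⟩ (fun _ p => next p) n
  have hmono : ∀ i j, i ≤ j → CutAbove G (c i).1.1 (c i).1.2 s (c j).1 := by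
    intro i j hij
    induction j, hij using Nat.le_induction with
    | base => exact ⟨(c i).2.1, subset_rfl, subset_rfl, (c i).2.2.2.2⟩
    | succ j _ ih => exact ih.trans (h1 (c j))
  refine ⟨fun i => y (c i), ⟨fun i => h2 _, fun i => ?_⟩, fun i hi => h3 _ ((c i).2.2.1 hi)⟩
  refine ⟨(c (i + 1)).1.1 ∩ (c (i + 1)).1.2, (c (i + 1)).2.1.1.fin, fun j hij => ?_⟩
  have hm := hmono (i + 1) j hij
  have ha : y (c i) ∉ (c (i + 1)).1.2 := h5 (c i)
  have ha' : y (c i) ∈ (c (i + 1)).1.1 := h4 (c i)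
  have hb : y (c j) ∉ (c (i + 1)).1.1 := fun e => h3 (c j) (hm.2.1 e)
  have hcut := (c (i + 1)).2.1.1
  refine ⟨fun e => hb ((show y (c i) = y (c j) from e) ▸ ha'), fun e => hcut.noedge _ _ e ha hb, fun u hu hu' => ⟨?_, ?_⟩⟩
  · by_contra hn
    exact hcut.noedge _ _ hu.symm ha hn
  · by_contra hn
    exact hcut.noedge _ _ hu' hn hb

theorem OutSpread.apart {s : V} {y : ℕ → V} (hy : OutSpread G E s y) {i j : ℕ} (hij : i ≠ j) :
    y i ≠ y j ∧ ¬ G.Adj (y i) (y j) := by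
  rcases lt_or_gt_of_ne hij with h | h
  · obtain ⟨S, -, hS⟩ := hy.2 i
    exact ⟨(hS j h).1, (hS j h).2.1⟩
  · obtain ⟨S, -, hS⟩ := hy.2 j
    exact ⟨(hS i h).1.symm, fun e => (hS i h).2.1 e.symm⟩

theorem OutSpread.injective {s : V} {y : ℕ → V} (hy : OutSpread G E s y) :
    Function.Injective y := by
  intro i j hij
  by_contra hne
  exact (hy.apart hne).1 hij

/-- The common neighbours of all members of a sequence. -/
def CommonNbrs (G : SimpleGraph V) (y : ℕ → V) : Set V := {u | ∀ i, G.Adj u (y i)}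

theorem OutSpread.finite_commonNbrs {s : V} {y : ℕ → V} (hy : OutSpread G E s y) :
    (CommonNbrs G y).Finite := by
  obtain ⟨S, hS, h⟩ := hy.2 0
  exact hS.subset (fun u hu => (h 1 (by omega)).2.2 u (hu 0) (hu 1))

theorem ConnHom.adj_of_adj_of_adj (h : ConnHom G E) {s : V} {y : ℕ → V}
    (hy : OutSpread G E s y) {s' a b c u : V} (ha : E s' a) (hb : E s' b) (hc : E s' c)
    (hab : a ≠ b ∧ ¬ G.Adj a b) (hac : a ≠ c ∧ ¬ G.Adj a c) (hbc : b ≠ c ∧ ¬ G.Adj b c)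
    (hua : G.Adj u a) (hub : G.Adj u b) : G.Adj u c := by
  obtain ⟨S, hS, hS'⟩ := hy.2 0
  obtain ⟨i, j, hij, hcn⟩ : ∃ i j, i ≠ j ∧ {u | G.Adj u (y 0) ∧ G.Adj u (y (i + 1))} =
      {u | G.Adj u (y 0) ∧ G.Adj u (y (j + 1))} := by
    have := hS.finite_subsets.to_subtype
    obtain ⟨i, j, hij, e⟩ := Finite.exists_ne_map_eq_of_infinite
      (fun i : ℕ => (⟨{u | G.Adj u (y 0) ∧ G.Adj u (y (i + 1))},
        fun u hu => (hS' (i + 1) (by omega)).2.2 u hu.1 hu.2⟩ : ↥{T : Set V | T ⊆ S}))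
    exact ⟨i, j, hij, congrArg Subtype.val e⟩
  obtain ⟨ψ, -, -, h1, h2, h3⟩ := h.triple_transitive (s := s') (s' := s) (Or.inl ⟨ha, hy.1 0⟩)
    (Or.inl ⟨hb, hy.1 (i + 1)⟩) (Or.inl ⟨hc, hy.1 (j + 1)⟩) hab hac hbc
    (hy.apart (by omega)) (hy.apart (by omega)) (hy.apart (by omega))
  have hmem : ψ u ∈ {u | G.Adj u (y 0) ∧ G.Adj u (y (i + 1))} :=
    ⟨h1 ▸ ψ.map_adj_iff.2 hua, h2 ▸ ψ.map_adj_iff.2 hub⟩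
  rw [hcn] at hmem
  have := hmem.2
  rw [← h3] at this
  exact ψ.map_adj_iff.1 this

theorem ConnHom.mem_commonNbrs (h : ConnHom G E) {s : V} {y : ℕ → V}
    (hy : OutSpread G E s y) {u : V} {i j : ℕ} (hij : i ≠ j) (hi : G.Adj u (y i))
    (hj : G.Adj u (y j)) : u ∈ CommonNbrs G y := by
  intro m
  by_cases h1 : m = i
  · exact h1 ▸ hi
  by_cases h2 : m = j
  · exact h2 ▸ hj
  exact h.adj_of_adj_of_adj hy (hy.1 i) (hy.1 j) (hy.1 m) (hy.apart hij) (hy.apart (Ne.symm h1))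
    (hy.apart (Ne.symm h2)) hi hj

theorem ConnHom.adj_of_mem_commonNbrs (h : ConnHom G E) {s : V} {y : ℕ → V}
    (hy : OutSpread G E s y) {t z : V} (ht : t ∈ CommonNbrs G y) (hz : E s z)
    (hzJ : z ∉ CommonNbrs G y) : G.Adj t z := by
  by_contra htz
  have hne : ∀ i, z ≠ y i := fun i e => htz (e ▸ ht i)
  have hpair : ∀ i j, i ≠ j → G.Adj z (y i) ∨ G.Adj z (y j) := by
    intro i j hij
    by_contra hcon
    rw [not_or] at hcon
    exact htz (h.adj_of_adj_of_adj hy (hy.1 i) (hy.1 j) hz (hy.apart hij)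
      ⟨(hne i).symm, fun e => hcon.1 e.symm⟩ ⟨(hne j).symm, fun e => hcon.2 e.symm⟩ (ht i) (ht j))
  have h01 := hpair 0 1 (by omega)
  have h02 := hpair 0 2 (by omega)
  have h12 := hpair 1 2 (by omega)
  rcases h01 with e | e
  · rcases h12 with e' | e'
    · exact hzJ (h.mem_commonNbrs hy (by omega) e e')
    · exact hzJ (h.mem_commonNbrs hy (by omega) e e')
  · rcases h02 with e' | e'
    · exact hzJ (h.mem_commonNbrs hy (by omega) e e')
    · exact hzJ (h.mem_commonNbrs hy (by omega) e e')

theorem ConnHom.not_adj_commonNbrs (h : ConnHom G E) {s : V} {y : ℕ → V}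
    (hy : OutSpread G E s y) {t : V} (ht : t ∈ CommonNbrs G y) : ¬ G.Adj s t := by
  intro hst
  have hfin : {z | E s z ∧ ¬ G.Adj t z}.Finite := hy.finite_commonNbrs.subset (by
    intro z hz
    by_contra hzJ
    exact hz.2 (h.adj_of_mem_commonNbrs hy ht hz.1 hzJ))
  rcases (h.adj s t).1 hst with e | e
  · obtain ⟨ψ, h1, h2, h3⟩ := h.edge_transitive (Or.inl ⟨e, hy.1 0⟩)
    have : Set.InjOn (fun i => ψ.symm (y (i + 1))) univ := by
      intro i _ j _ hij
      have := hy.injective (ψ.symm.injective hij)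
      omega
    refine infinite_of_injOn_mapsTo this (t := {z | E s z ∧ ¬ G.Adj t z}) (fun i _ => ⟨?_, ?_⟩)
      infinite_univ hfin
    · rw [← h1, h2]
      simpa using hy.1 (i + 1)
    · rw [← ψ.map_adj_iff, h3]
      simpa using (hy.apart (i := 0) (j := i + 1) (by omega)).2
  · have hin : ∀ z, E z s → z ∈ CommonNbrs G y := by
      intro z hz
      obtain ⟨ψ, h1, h2, h3⟩ := h.edge_transitive (Or.inr ⟨hz, e⟩ : SameType E s z s t)
      have hfin' : {w | E s w ∧ ¬ G.Adj z w}.Finite := by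
        have : {w | E s w ∧ ¬ G.Adj z w} = ψ ⁻¹' {z | E s z ∧ ¬ G.Adj t z} := by
          ext w
          simp only [mem_ofPred_eq, mem_preimage]
          rw [← h1 s w, h2, ← ψ.map_adj_iff (v := z), h3]
        rw [this]
        exact hfin.preimage ψ.injective.injOn
      have hidx : {i | ¬ G.Adj z (y i)}.Finite :=
        (hfin'.preimage hy.injective.injOn).subset (fun i hi => ⟨hy.1 i, hi⟩)
      obtain ⟨i, hi⟩ := hidx.exists_notMem
      obtain ⟨j, hj⟩ := (hidx.union (finite_singleton i)).exists_notMem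
      simp only [mem_union, mem_singleton_iff, not_or, mem_ofPred_eq, not_not] at hi hj
      exact h.mem_commonNbrs hy (Ne.symm hj.2) hi hj.1
    have hinfin : {z | E z s}.Finite := hy.finite_commonNbrs.subset hin
    have htrans : ∀ w, {z | E z w}.Finite ∧ {z | E z w}.ncard = {z | E z s}.ncard := by
      intro w
      obtain ⟨ψ, h1, h2⟩ := h.vertex_transitive w s
      have e : {z | E z w} = ψ ⁻¹' {z | E z s} := by
        ext z
        simp only [mem_ofPred_eq, mem_preimage]
        rw [← h1, h2]
      rw [e]
      exact ⟨hinfin.preimage ψ.injective.injOn, ncard_preimage_of_injective_subset_range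
        ψ.injective (by simp [ψ.surjective.range_eq])⟩
    have hbad : {i | ∃ z, E z s ∧ E (y i) z}.Finite := by
      have : (⋃ z ∈ {z | E z s}, {w | E w z}).Finite :=
        hinfin.biUnion (fun z _ => (htrans z).1)
      refine (this.preimage hy.injective.injOn).subset ?_
      rintro i ⟨z, hz, hyz⟩
      exact mem_biUnion (show z ∈ {z | E z s} from hz) hyz
    obtain ⟨i, hi⟩ := hbad.exists_notMem
    have hsub : insert s {z | E z s} ⊆ {z | E z (y i)} := by
      rintro z (rfl | hz)
      · exact hy.1 i
      · rcases (h.adj _ _).1 (hin z hz i) with e' | e'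
        · exact e'
        · exact absurd ⟨z, hz, e'⟩ hi
    have h1 := ncard_le_ncard hsub (htrans (y i)).1
    have h2 := ncard_insert_of_notMem (s := {z | E z s}) (a := s)
      (fun hs => (h.adj_out hs).ne rfl) hinfin
    rw [h2, (htrans (y i)).2] at h1
    omega

theorem EdgeCut.exists_in_not_mem (he : EdgeCut G) (h : ConnHom G E) (hc : MinCut G A B) {s : V}
    (hs : s ∈ A ∩ B) : ∃ z, z ∉ A ∧ E z s := by
  by_contra hcon
  push Not at hcon
  obtain ⟨y, hy, hyA⟩ := he.exists_outSpread (E := E) (fun _ _ => h.adj_out) hc hs (by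
    intro p hp
    obtain ⟨y, hyp, hsy⟩ := hp.1.exists_adj_not_mem_left hp.2.2.2
    refine ⟨y, hyp, ((h.adj _ _).1 hsy).resolve_right (hcon y (fun e => hyp (hp.2.1 e)))⟩)
  have hz : ∀ i, ∃ z, E z s ∧ G.Adj z (y i) ∧ z ∈ A ∩ B := by
    intro i
    obtain ⟨z, hzs, hzy⟩ := h.near_in s (y i) (h.adj_out (hy.1 i))
    have hzA : z ∈ A := by
      by_contra hzA
      exact hcon z hzA hzs
    rcases hzy with rfl | hzy
    · exact absurd hzA (hyA i)
    · refine ⟨z, hzs, hzy, hzA, ?_⟩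
      by_contra hzB
      exact hc.1.noedge _ _ hzy hzB (hyA i)
  choose z hz1 hz2 hz3 using hz
  have := hc.1.fin.to_subtype
  obtain ⟨i, j, hij, e⟩ := Finite.exists_ne_map_eq_of_infinite
    (fun i : ℕ => (⟨z i, hz3 i⟩ : ↥(A ∩ B)))
  have e' : z i = z j := congrArg Subtype.val e
  exact h.not_adj_commonNbrs hy (h.mem_commonNbrs hy hij (hz2 i) (e' ▸ hz2 j)) (h.adj_in (hz1 i))

theorem ConnHom.exists_in_not_mem (h : ConnHom G E) (hc : MinCut G A B) {s : V}
    (hs : s ∈ A ∩ B) : ∃ z, z ∉ A ∧ E z s := by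
  by_cases hm : ∃ A B, MinCut G A B ∧ ∃ x y, x ∈ A ∩ B ∧ y ∈ A ∩ B ∧ G.Adj x y
  · have he : EdgeCut G := fun s t hst => h.exists_minCut_edge hm hst
    exact he.exists_in_not_mem h hc hs
  · push Not at hm
    obtain ⟨y, hyA, hsy⟩ := hc.exists_adj_not_mem_left hs
    obtain ⟨z, hzs, hzy⟩ := h.near_in s y hsy
    refine ⟨z, fun hzA => ?_, hzs⟩
    rcases hzy with rfl | hzy
    · exact hyA hzA
    · have hzB : z ∈ B := by
        by_contra hzB
        exact hc.1.noedge _ _ hzy hzB hyA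
      exact hm A B hc s z hs ⟨hzA, hzB⟩ (h.adj_in hzs)

theorem ConnHom.exists_split (h : ConnHom G E) (hm : ∃ A B, MinCut G A B) {q a b : V}
    (ha : G.Adj q a) (hb : G.Adj q b) (hab : a ≠ b) (hnab : ¬ G.Adj a b) :
    ∃ A B, MinCut G A B ∧ q ∈ A ∩ B ∧ a ∉ B ∧ b ∉ A := by
  obtain ⟨A, B, hc, hs⟩ := h.exists_minCut_mem hm q
  have hs' : q ∈ B ∩ A := ⟨hs.2, hs.1⟩
  have key : ∀ c d, c ∉ B → d ∉ A → SameType E q a q c → SameType E q b q d →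
      ∃ A B, MinCut G A B ∧ q ∈ A ∩ B ∧ a ∉ B ∧ b ∉ A := by
    intro c d hcB hdA hac hbd
    obtain ⟨ψ, -, h1, h2, h3⟩ := h.pair_transitive hac hbd ⟨hab, hnab⟩
      ⟨fun e => (hc.1.cover c).elim (fun h' => hdA (e ▸ h')) hcB,
        fun e => hc.1.noedge _ _ e hcB hdA⟩
    refine ⟨_, _, hc.preimage ψ, ?_, ?_, ?_⟩
    · rw [← preimage_inter, mem_preimage, h1]
      exact hs
    · rw [mem_preimage, h2]
      exact hcB
    · rw [mem_preimage, h3]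
      exact hdA
  obtain ⟨ci, hci, hci'⟩ := h.exists_in_not_mem hc.symm hs'
  obtain ⟨co, hco, hco'⟩ := h.flip.exists_in_not_mem hc.symm hs'
  obtain ⟨di, hdi, hdi'⟩ := h.exists_in_not_mem hc hs
  obtain ⟨d, hd, hd'⟩ := h.flip.exists_in_not_mem hc hs
  rcases (h.adj _ _).1 ha with e | e <;> rcases (h.adj _ _).1 hb with e' | e'
  · exact key co d hco hd (Or.inl ⟨e, hco'⟩) (Or.inl ⟨e', hd'⟩)
  · exact key co di hco hdi (Or.inl ⟨e, hco'⟩) (Or.inr ⟨e', hdi'⟩)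
  · exact key ci d hci hd (Or.inr ⟨e, hci'⟩) (Or.inl ⟨e', hd'⟩)
  · exact key ci di hci hdi (Or.inr ⟨e, hci'⟩) (Or.inr ⟨e', hdi'⟩)

end Spread

section Blocks

variable {V : Type u} {G : SimpleGraph V} {E : V → V → Prop} {A B : Set V}

/-- The graph with all edges at `q` removed. -/
def isolate (G : SimpleGraph V) (q : V) : SimpleGraph V where
  Adj a b := G.Adj a b ∧ a ≠ q ∧ b ≠ q
  symm := ⟨fun _ _ h => ⟨h.1.symm, h.2.2, h.2.1⟩⟩
  loopless := ⟨fun _ h => h.1.ne rfl⟩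

/-- Two neighbours of `q` that are connected avoiding `q` are equal or adjacent: every block is
complete. -/
def CompleteBlocks (G : SimpleGraph V) : Prop :=
  ∀ q a b, G.Adj q a → G.Adj q b → (isolate G q).Reachable a b → a = b ∨ G.Adj a b

theorem SimpleGraph.Reachable.exists_geodesic {H : SimpleGraph V} {a b : V}
    (h : H.Reachable a b) : ∃ p : ℕ → V, p 0 = a ∧ p (H.dist a b) = b ∧
      (∀ i, i < H.dist a b → H.Adj (p i) (p (i + 1))) ∧
      (∀ i j, i ≤ j → j ≤ H.dist a b → ∃ w : H.Walk (p i) (p j), w.length = j - i) ∧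
      (∀ i j, i ≤ j → j ≤ H.dist a b → p i = p j → i = j) ∧
      (∀ i j, i ≤ j → j ≤ H.dist a b → H.Adj (p i) (p j) → j ≤ i + 1) := by
  obtain ⟨w, hw⟩ := h.exists_walk_length_eq_dist
  have hadj : ∀ i, i < H.dist a b → H.Adj (w.getVert i) (w.getVert (i + 1)) :=
    fun i hi => w.adj_getVert_succ (hw ▸ hi)
  have hwalk : ∀ i j, i ≤ j → j ≤ H.dist a b →
      ∃ w' : H.Walk (w.getVert i) (w.getVert j), w'.length = j - i := by
    intro i j hij
    induction j, hij using Nat.le_induction with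
    | base => exact fun _ => ⟨.nil, by simp⟩
    | succ j hij ih =>
      intro hj
      obtain ⟨w', hw'⟩ := ih (by omega)
      exact ⟨w'.concat (hadj j (by omega)), by rw [SimpleGraph.Walk.length_concat]; omega⟩
  have h0 : w.getVert 0 = a := w.getVert_zero
  have hn : w.getVert (H.dist a b) = b := by rw [← hw]; exact w.getVert_length
  have hlen : ∀ {x y : V} (w' : H.Walk x y), x = a → y = b → H.dist a b ≤ w'.length := by
    rintro x y w' rfl rfl
    exact SimpleGraph.dist_le w'
  refine ⟨w.getVert, h0, hn, hadj, hwalk, ?_, ?_⟩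
  · intro i j hij hj e
    obtain ⟨w1, h1⟩ := hwalk 0 i (Nat.zero_le _) (by omega)
    obtain ⟨w2, h2⟩ := hwalk j _ hj le_rfl
    have := hlen (w1.append (w2.copy e.symm rfl)) h0 hn
    rw [SimpleGraph.Walk.length_append, SimpleGraph.Walk.length_copy] at this
    omega
  · intro i j hij hj e
    obtain ⟨w1, h1⟩ := hwalk 0 i (Nat.zero_le _) (by omega)
    obtain ⟨w2, h2⟩ := hwalk j _ hj le_rfl
    have := hlen (w1.append (.cons e w2)) h0 hn
    rw [SimpleGraph.Walk.length_append, SimpleGraph.Walk.length_cons] at this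
    omega

/-- An induced path `p 0, …, p n` whose ends are the only neighbours of `q` on it. -/
structure InducedCycle (G : SimpleGraph V) (q : V) (n : ℕ) (p : ℕ → V) : Prop where
  two_le : 2 ≤ n
  adj_zero : G.Adj q (p 0)
  adj_last : G.Adj q (p n)
  not_adj : ∀ i, 0 < i → i < n → ¬ G.Adj q (p i)
  ne : ∀ i, i ≤ n → p i ≠ q
  adj : ∀ i, i < n → G.Adj (p i) (p (i + 1))
  inj : ∀ i j, i < j → j ≤ n → p i ≠ p j
  induced : ∀ i j, i + 2 ≤ j → j ≤ n → ¬ G.Adj (p i) (p j)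

theorem exists_inducedCycle
    (hd : ∀ q a b u, G.Adj q a → G.Adj q b → a ≠ b → ¬ G.Adj a b → G.Adj u a → G.Adj u b →
      ¬ G.Adj u q) (hG : ¬ CompleteBlocks G) : ∃ q n p, InducedCycle G q n p := by
  classical
  unfold CompleteBlocks at hG
  push Not at hG
  obtain ⟨q, a, b, ha, hb, hr, hab, hnab⟩ := hG
  have hex : ∃ n a b, G.Adj q a ∧ G.Adj q b ∧ (isolate G q).Reachable a b ∧ a ≠ b ∧
    ¬ G.Adj a b ∧ (isolate G q).dist a b = n := ⟨_, a, b, ha, hb, hr, hab, hnab, rfl⟩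
  have hmin := fun m => Nat.find_min' hex (m := m)
  obtain ⟨a, b, ha, hb, hr, hab, hnab, hn⟩ := Nat.find_spec hex
  obtain ⟨p, h0, h1, hadj, hwalk, hinj, hind⟩ := hr.exists_geodesic
  rw [hn] at h1 hadj hwalk hinj hind
  generalize Nat.find hex = n at *
  subst h0 h1
  have hn2 : 2 ≤ n := by
    by_contra hlt
    rcases (by omega : n = 0 ∨ n = 1) with rfl | rfl
    · exact hab rfl
    · exact hnab (hadj 0 (by omega)).1
  have hne : ∀ i, i ≤ n → p i ≠ q := by
    intro i hi
    rcases Nat.lt_or_ge i n with hlt | hge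
    · exact (hadj i hlt).2.1
    · obtain rfl : i = n := le_antisymm hi hge
      exact hb.ne'
  have hind' : ∀ i j, i ≤ j → j ≤ n → G.Adj (p i) (p j) → j ≤ i + 1 := fun i j hij hj e =>
    hind i j hij hj ⟨e, hne i (by omega), hne j hj⟩
  refine ⟨q, n, p, hn2, ha, hb, ?_, hne, fun i hi => (hadj i hi).1, ?_, ?_⟩
  · intro i hi0 hin hqi
    have c1 : G.Adj (p 0) (p i) := by
      by_contra hna
      obtain ⟨w, hw⟩ := hwalk 0 i (Nat.zero_le _) hin.le
      have hle := SimpleGraph.dist_le w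
      have := hmin _ ⟨_, _, ha, hqi, w.reachable,
        fun e => absurd (hinj 0 i (Nat.zero_le _) hin.le e) (by omega), hna, rfl⟩
      omega
    have c2 : G.Adj (p i) (p n) := by
      by_contra hna
      obtain ⟨w, hw⟩ := hwalk i n hin.le le_rfl
      have hle := SimpleGraph.dist_le w
      have := hmin _ ⟨_, _, hqi, hb, w.reachable,
        fun e => absurd (hinj i n hin.le le_rfl e) (by omega), hna, rfl⟩
      omega
    exact hd q _ _ _ ha hb hab hnab c1.symm c2 hqi.symm
  · exact fun i j hij hj e => absurd (hinj i j hij.le hj e) (by omega)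
  · exact fun i j hij hj e => absurd (hind' i j (by omega) hj e) (by omega)

theorem InducedCycle.ends {q : V} {n : ℕ} {p : ℕ → V} (hp : InducedCycle G q n p) :
    p 0 ≠ p n ∧ ¬ G.Adj (p 0) (p n) :=
  have := hp.two_le
  ⟨hp.inj 0 n (by omega) le_rfl, hp.induced 0 n (by omega) le_rfl⟩

theorem common_nbr_mem {a b u : V} (hc : EndCut G A B) (ha : a ∉ B) (hb : b ∉ A)
    (hua : G.Adj u a) (hub : G.Adj u b) : u ∈ A ∩ B := by
  refine ⟨?_, ?_⟩
  · by_contra hn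
    exact hc.noedge _ _ hua.symm ha hn
  · by_contra hn
    exact hc.noedge _ _ hub hn hb

theorem ConnHom.completeBlocks_of_independent (h : ConnHom G E) (hm : ∃ A B, MinCut G A B)
    (hind : ∀ A B, MinCut G A B → ∀ x y, x ∈ A ∩ B → y ∈ A ∩ B → ¬ G.Adj x y) :
    CompleteBlocks G := by
  by_contra hG
  obtain ⟨q, n, p, hp⟩ := exists_inducedCycle (by
    intro q a b u hqa hqb hab hnab hua hub
    obtain ⟨A, B, hc, hq, haB, hbA⟩ := h.exists_split hm hqa hqb hab hnab
    exact hind A B hc u q (common_nbr_mem hc.1 haB hbA hua hub) hq) hG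
  obtain ⟨A₀, B₀, hc₀, hq₀, h0, hlast⟩ :=
    h.exists_split hm hp.adj_zero hp.adj_last hp.ends.1 hp.ends.2
  have key : ∀ i, i ≤ n → ∃ v A B, MinCut G A B ∧ A ⊆ A₀ ∧ v ∈ A ∩ B ∧ p i ∈ A ∧ p i ∉ B ∧
      G.Adj v (p i) ∧ (i < n → v ≠ p (i + 1) ∧ ¬ G.Adj v (p (i + 1))) := by
    intro i
    induction i with
    | zero =>
      intro _
      have := hp.two_le
      exact ⟨q, A₀, B₀, hc₀, subset_rfl, hq₀, hc₀.1.not_mem_right h0, h0, hp.adj_zero,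
        fun _ => ⟨(hp.ne 1 (by omega)).symm, hp.not_adj 1 (by omega) (by omega)⟩⟩
    | succ i ih =>
      intro hi
      obtain ⟨v, A, B, hc, hA, hv, hwA, hwB, hvw, hnext⟩ := ih (by omega)
      obtain ⟨hne, hna⟩ := hnext hi
      obtain ⟨A', B', hc', hw', hvB', hw'A'⟩ :=
        h.exists_split hm hvw.symm (hp.adj i hi) hne hna
      have hvA' := hc'.1.not_mem_right hvB'
      have hw'B' := hc'.1.not_mem_left hw'A'
      have hw'A : p (i + 1) ∈ A := by
        by_contra hn
        exact hc.1.noedge _ _ (hp.adj i hi) hwB hn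
      rcases hc.1.corners hc'.1 with ⟨h1, h2⟩ | ⟨h1, h2⟩
      · exact (hind _ _ (hc.uncross hc' h1 h2).2 v (p i) ⟨⟨hv.1, hvA'⟩, Or.inl hv.2⟩
          ⟨⟨hwA, hw'.1⟩, Or.inr hw'.2⟩ hvw).elim
      · have hcut := (hc.uncross hc'.symm h1 h2).2
        refine ⟨p i, _, _, hcut, inter_subset_left.trans hA, ⟨⟨hwA, hw'.2⟩, Or.inr hw'.1⟩,
          ⟨hw'A, hw'B'⟩, fun hn => ?_, hp.adj i hi, fun hlt => ⟨hp.inj _ _ (by omega) (by omega),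
          hp.induced _ _ (by omega) (by omega)⟩⟩
        exact hind _ _ hcut (p i) (p (i + 1)) ⟨⟨hwA, hw'.2⟩, Or.inr hw'.1⟩
          ⟨⟨hw'A, hw'B'⟩, hn⟩ (hp.adj i hi)
  obtain ⟨_, A, _, _, hA, _, hn, _⟩ := key n le_rfl
  exact hlast (hA hn)

end Blocks

section EdgeCase

variable {V : Type u} {G : SimpleGraph V} {E : V → V → Prop} {A B : Set V}

theorem InducedCycle.map {q : V} {n : ℕ} {p : ℕ → V} (hp : InducedCycle G q n p) (g : G ≃g G)
    (hg : g q = q) : InducedCycle G q n (fun i => g (p i)) where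
  two_le := hp.two_le
  adj_zero := by
    have := g.map_adj_iff.2 hp.adj_zero
    rwa [hg] at this
  adj_last := by
    have := g.map_adj_iff.2 hp.adj_last
    rwa [hg] at this
  not_adj i h0 hn e := by
    have e' : G.Adj (g q) (g (p i)) := by rwa [hg]
    exact hp.not_adj i h0 hn (g.map_adj_iff.1 e')
  ne i hi e := hp.ne i hi (g.injective (e.trans hg.symm))
  adj i hi := g.map_adj_iff.2 (hp.adj i hi)
  inj i j hij hj e := hp.inj i j hij hj (g.injective e)
  induced i j hij hj e := hp.induced i j hij hj (g.map_adj_iff.1 e)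

theorem EdgeCut.exists_outSpread_not_mem (he : EdgeCut G) (h : ConnHom G E) (hc : MinCut G A B)
    {s : V} (hs : s ∈ A ∩ B) : ∃ y, OutSpread G E s y ∧ ∀ i, y i ∉ A :=
  he.exists_outSpread (fun _ _ => h.adj_out) hc hs
    (fun _ hp => h.flip.exists_in_not_mem hp.1 hp.2.2.2)

theorem ConnHom.commonNbrs_eq (h : ConnHom G E) (hm : ∃ A B, MinCut G A B) {s : V} {y : ℕ → V}
    (hy : OutSpread G E s y) {t : V} (ht : t ∈ CommonNbrs G y) : t = s := by
  by_contra hts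
  obtain ⟨A, B, hc, -, h1, h2⟩ := h.exists_split hm (ht 0).symm (h.adj_in (hy.1 0)) hts
    (fun e => h.not_adj_commonNbrs hy ht e.symm)
  exact infinite_of_injOn_mapsTo (f := y) (t := A ∩ B) hy.injective.injOn
    (fun i _ => common_nbr_mem hc.1 h1 h2 (ht i).symm (h.adj_in (hy.1 i))) infinite_univ hc.1.fin

theorem ConnHom.eq_of_out_out (h : ConnHom G E) (he : EdgeCut G) (hm : ∃ A B, MinCut G A B)
    {q a b u : V} (ha : E q a) (hb : E q b) (hab : a ≠ b ∧ ¬ G.Adj a b) (hua : G.Adj u a)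
    (hub : G.Adj u b) : u = q := by
  obtain ⟨A, B, hc, hq⟩ := h.exists_minCut_mem hm q
  obtain ⟨y, hy, -⟩ := he.exists_outSpread_not_mem h hc hq
  obtain ⟨ψ, -, h1, h2, h3⟩ := h.pair_transitive (Or.inl ⟨ha, hy.1 0⟩ : SameType E q a q (y 0))
    (Or.inl ⟨hb, hy.1 1⟩) hab (hy.apart (by omega))
  have hu : ψ u ∈ CommonNbrs G y := h.mem_commonNbrs hy (i := 0) (j := 1) (by omega)
    (h2 ▸ ψ.map_adj_iff.2 hua) (h3 ▸ ψ.map_adj_iff.2 hub)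
  exact ψ.injective ((h.commonNbrs_eq hm hy hu).trans h1.symm)

theorem ConnHom.eq_of_in_out (h : ConnHom G E) (he : EdgeCut G) (hm : ∃ A B, MinCut G A B)
    {q a b u : V} (ha : E a q) (hb : E q b) (hab : a ≠ b ∧ ¬ G.Adj a b) (hua : G.Adj u a)
    (hub : G.Adj u b) : u = q := by
  by_contra huq
  obtain ⟨A, B, hc, hq⟩ := h.exists_minCut_mem hm q
  obtain ⟨y, hy, hyA⟩ := he.exists_outSpread_not_mem h hc hq
  obtain ⟨z, hzB, hzq⟩ := h.exists_in_not_mem hc.symm ⟨hq.2, hq.1⟩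
  have hv : ∀ i, ∃ v, v ≠ q ∧ G.Adj v (y i) ∧ v ∈ A ∩ B := by
    intro i
    obtain ⟨ψ, -, h1, h2, h3⟩ := h.pair_transitive (Or.inr ⟨ha, hzq⟩ : SameType E q a q z)
      (Or.inl ⟨hb, hy.1 i⟩) hab ⟨fun e => hyA i (e ▸ hc.1.not_mem_right hzB),
        fun e => hc.1.noedge _ _ e hzB (hyA i)⟩
    have e1 : G.Adj (ψ u) z := h2 ▸ ψ.map_adj_iff.2 hua
    have e2 : G.Adj (ψ u) (y i) := h3 ▸ ψ.map_adj_iff.2 hub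
    exact ⟨ψ u, fun e => huq (ψ.injective (e.trans h1.symm)), e2,
      common_nbr_mem hc.1 hzB (hyA i) e1 e2⟩
  choose v hv1 hv2 hv3 using hv
  have := hc.1.fin.to_subtype
  obtain ⟨i, j, hij, e⟩ := Finite.exists_ne_map_eq_of_infinite
    (fun i : ℕ => (⟨v i, hv3 i⟩ : ↥(A ∩ B)))
  have e' : v i = v j := congrArg Subtype.val e
  exact hv1 i (h.commonNbrs_eq hm hy (h.mem_commonNbrs hy hij (hv2 i) (e' ▸ hv2 j)))

theorem ConnHom.eq_of_common_nbrs (h : ConnHom G E) (he : EdgeCut G) (hm : ∃ A B, MinCut G A B)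
    {q a b u : V} (ha : G.Adj q a) (hb : G.Adj q b) (hab : a ≠ b) (hnab : ¬ G.Adj a b)
    (hua : G.Adj u a) (hub : G.Adj u b) : u = q := by
  rcases (h.adj _ _).1 ha with e | e <;> rcases (h.adj _ _).1 hb with e' | e'
  · exact h.eq_of_out_out he hm e e' ⟨hab, hnab⟩ hua hub
  · exact h.eq_of_in_out he hm e' e ⟨hab.symm, fun e => hnab e.symm⟩ hub hua
  · exact h.eq_of_in_out he hm e e' ⟨hab, hnab⟩ hua hub
  · exact h.flip.eq_of_out_out he hm e e' ⟨hab, hnab⟩ hua hub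

theorem ConnHom.exists_spread_nbrs (h : ConnHom G E) (he : EdgeCut G)
    (hm : ∃ A B, MinCut G A B) {y w : V} (hyw : G.Adj y w) :
    ∃ v : ℕ → V, (∀ i, SameType E y w y (v i)) ∧
      ∀ i j, i ≠ j → v i ≠ v j ∧ ¬ G.Adj (v i) (v j) := by
  obtain ⟨A, B, hc, hq⟩ := h.exists_minCut_mem hm y
  rcases (h.adj _ _).1 hyw with e | e
  · obtain ⟨v, hv, -⟩ := he.exists_outSpread_not_mem h hc hq
    exact ⟨v, fun i => Or.inl ⟨e, hv.1 i⟩, fun i j hij => hv.apart hij⟩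
  · obtain ⟨v, hv, -⟩ := he.exists_outSpread_not_mem h.flip hc hq
    exact ⟨v, fun i => Or.inr ⟨e, hv.1 i⟩, fun i j hij => hv.apart hij⟩

theorem ConnHom.exists_moving (h : ConnHom G E) (he : EdgeCut G) (hm : ∃ A B, MinCut G A B)
    {F S : Set V} (hF : F.Finite) (hFc : (G.induce F).Connected) (hS : S.Finite) {y w w' : V}
    (hy : y ∈ F) (hw : w ∉ F) (hyw : G.Adj y w) (hwF : ∀ f ∈ F, G.Adj w f → f = y)
    (hww' : G.Adj w w') (hw'y : w' ≠ y) :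
    ∃ g : G ≃g G, (∀ f ∈ F, g f = f) ∧ g w ∉ S ∧ g w' ∉ S := by
  classical
  obtain ⟨v, hty, hap⟩ := h.exists_spread_nbrs he hm hyw
  have hinj : Function.Injective v := by
    intro i j hij
    by_contra hne
    exact (hap i j hne).1 hij
  have hyv : ∀ i, G.Adj y (v i) := fun i => (h.adj _ _).2 ((hty i).imp And.right And.right)
  have hirr : ∀ x, ¬ E x x := fun x hx => (h.adj_out hx).ne rfl
  have huniq : ∀ f i j, f ≠ y → G.Adj f (v i) → G.Adj f (v j) → i = j := by
    intro f i j hf h1 h2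
    by_contra hij
    exact hf (h.eq_of_common_nbrs he hm (hyv i) (hyv j) (hap i j hij).1 (hap i j hij).2 h1 h2)
  have hXc : (G.induce (insert w F)).Connected := by
    refine SimpleGraph.connected_induce_of_forall_reachable (a := y) (mem_insert_of_mem _ hy)
      (fun U hU hcl => ?_)
    have hFU : F ⊆ U := hFc.subset_of_closed hy hU (fun x z hx hz =>
      hcl x z (mem_insert_of_mem _ hx) (mem_insert_of_mem _ hz))
    exact insert_subset (hcl y w (mem_insert_of_mem _ hy) (mem_insert _ _) hyw hU) hFU
  have hbad1 : {i | v i ∈ F}.Finite := hF.preimage hinj.injOn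
  have hbad2 : {i | ∃ f ∈ F, f ≠ y ∧ G.Adj f (v i)}.Finite := by
    have : (⋃ f ∈ F, {i | f ≠ y ∧ G.Adj f (v i)}).Finite := by
      refine hF.biUnion (fun f _ => Set.Subsingleton.finite ?_)
      intro i hi j hj
      exact huniq f i j hi.1 hi.2 hj.2
    refine this.subset ?_
    rintro i ⟨f, hf, h1⟩
    exact mem_biUnion hf h1
  set Bad : Set ℕ := {i | v i ∈ F} ∪ {i | ∃ f ∈ F, f ≠ y ∧ G.Adj f (v i)} with hBad
  have hg : ∀ i, ∃ g : G ≃g G, i ∉ Bad → (∀ f ∈ F, g f = f) ∧ g w = v i := by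
    intro i
    by_cases hi : i ∈ Bad
    · exact ⟨RelIso.refl _, fun h => absurd hi h⟩
    have h1 : v i ∉ F := fun e => hi (Or.inl e)
    have h2 : ∀ f ∈ F, f ≠ y → ¬ G.Adj f (v i) := fun f hf hfy e => hi (Or.inr ⟨f, hf, hfy, e⟩)
    have hid : ∀ f ∈ F, Function.update id w (v i) f = f := by
      intro f hf
      exact Function.update_of_ne (fun e : f = w => hw (e ▸ hf)) _ _
    have hwE : ∀ f ∈ F, (E (v i) f ↔ E w f) ∧ (E f (v i) ↔ E f w) := by
      intro f hf
      by_cases hfy : f = y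
      · subst hfy
        rcases hty i with ⟨e1, e2⟩ | ⟨e1, e2⟩ <;> rcases h.symm_or with hs | hs
        · exact ⟨iff_of_true (hs _ _ e2) (hs _ _ e1), iff_of_true e2 e1⟩
        · exact ⟨iff_of_false (hs _ _ e2) (hs _ _ e1), iff_of_true e2 e1⟩
        · exact ⟨iff_of_true e2 e1, iff_of_true (hs _ _ e2) (hs _ _ e1)⟩
        · exact ⟨iff_of_true e2 e1, iff_of_false (hs _ _ e2) (hs _ _ e1)⟩
      · have n1 := h2 f hf hfy
        have n2 : ¬ G.Adj f w := fun e => hfy (hwF f hf e.symm)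
        rw [h.adj, not_or] at n1 n2
        exact ⟨iff_of_false n1.2 n2.2, iff_of_false n1.1 n2.1⟩
    obtain ⟨g, -, hg⟩ := h.extend (insert w F) (hF.insert w) hXc (Function.update id w (v i)) (by
      rintro a (rfl | ha) b (rfl | hb) hab
      · rfl
      · rw [hid b hb, Function.update_self] at hab
        exact absurd (hab ▸ hb) h1
      · rw [hid a ha, Function.update_self] at hab
        exact absurd (hab ▸ ha) h1
      · rwa [hid a ha, hid b hb] at hab) (by
      rintro a (rfl | ha) b (rfl | hb)
      · rw [Function.update_self]
        exact iff_of_false (hirr _) (hirr _)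
      · rw [Function.update_self, hid b hb]
        exact (hwE b hb).1
      · rw [Function.update_self, hid a ha]
        exact (hwE a ha).2
      · rw [hid a ha, hid b hb])
    refine ⟨g, fun _ => ⟨fun f hf => ?_, ?_⟩⟩
    · rw [hg f (mem_insert_of_mem _ hf), hid f hf]
    · rw [hg w (mem_insert _ _), Function.update_self]
  choose g hg using hg
  have hf1 : {i | v i ∈ S}.Finite := hS.preimage hinj.injOn
  have hf2 : {i | i ∉ Bad ∧ g i w' ∈ S}.Finite := by
    refine Set.Finite.of_finite_image (f := fun i => g i w') (hS.subset ?_) ?_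
    · rintro _ ⟨i, hi, rfl⟩
      exact hi.2
    · intro i hi j hj e
      simp only at e
      have e1 : G.Adj (g i w') (v i) := (hg i hi.1).2 ▸ (g i).map_adj_iff.2 hww'.symm
      have e2 : G.Adj (g i w') (v j) := e ▸ (hg j hj.1).2 ▸ (g j).map_adj_iff.2 hww'.symm
      refine huniq _ i j (fun e3 => ?_) e1 e2
      exact hw'y ((g i).injective (e3.trans ((hg i hi.1).1 y hy).symm))
  obtain ⟨i, hi⟩ := ((hbad1.union hbad2).union (hf1.union hf2)).exists_notMem
  have hiB : i ∉ Bad := fun e => hi (Or.inl e)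
  refine ⟨g i, (hg i hiB).1, fun e => hi (Or.inr (Or.inl ?_)), fun e => hi (Or.inr (Or.inr ?_))⟩
  · exact show v i ∈ S from (hg i hiB).2 ▸ e
  · exact ⟨hiB, e⟩

theorem connected_image_path {p : ℕ → V} {n : ℕ} (hp : ∀ i, i < n → G.Adj (p i) (p (i + 1))) :
    (G.induce (p '' {i | i ≤ n})).Connected := by
  refine SimpleGraph.connected_induce_of_forall_reachable (a := p 0) ⟨0, Nat.zero_le _, rfl⟩
    (fun U hU hcl => ?_)
  rintro _ ⟨i, hi, rfl⟩
  have hi' : i ≤ n := hi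
  clear hi
  induction i with
  | zero => exact hU
  | succ i ih =>
    exact hcl _ _ ⟨i, (by omega : i ≤ n), rfl⟩ ⟨i + 1, hi', rfl⟩ (hp i (by omega)) (ih (by omega))

theorem connected_insert {F : Set V} (hF : (G.induce F).Connected) {x y : V} (hy : y ∈ F)
    (hxy : G.Adj y x) : (G.induce (insert x F)).Connected := by
  refine SimpleGraph.connected_induce_of_forall_reachable (a := y) (mem_insert_of_mem _ hy)
    (fun U hU hcl => ?_)
  have hFU : F ⊆ U := hF.subset_of_closed hy hU (fun x z hx hz =>
    hcl x z (mem_insert_of_mem _ hx) (mem_insert_of_mem _ hz))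
  exact insert_subset (hcl y x (mem_insert_of_mem _ hy) (mem_insert _ _) hxy hU) hFU

theorem ConnHom.completeBlocks_of_edgeCut (h : ConnHom G E) (he : EdgeCut G)
    (hm : ∃ A B, MinCut G A B) : CompleteBlocks G := by
  by_contra hG
  obtain ⟨q, n, p, hp⟩ := exists_inducedCycle (by
    intro q a b u hqa hqb hab hnab hua hub huq
    exact huq.ne (h.eq_of_common_nbrs he hm hqa hqb hab hnab hua hub)) hG
  have hn : 3 ≤ n := by
    by_contra hlt
    obtain rfl : n = 2 := by have := hp.two_le; omega
    exact hp.ne 1 (by omega) (h.eq_of_common_nbrs he hm hp.adj_zero hp.adj_last hp.ends.1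
      hp.ends.2 (hp.adj 0 (by omega)).symm (hp.adj 1 (by omega)))
  obtain ⟨m, rfl⟩ := Nat.exists_eq_add_of_le' hn
  obtain ⟨A, B, hc, hq, h0, hlast⟩ :=
    h.exists_split hm hp.adj_zero hp.adj_last hp.ends.1 hp.ends.2
  obtain ⟨g, hg1, -, hg2⟩ := h.exists_moving he hm (S := A ∩ B)
    (F := insert (p (m + 3)) (insert q (p '' {i | i ≤ m}))) (y := p m) (w := p (m + 1))
    (w' := p (m + 2)) ((((finite_le_nat m).image p).insert _).insert _)
    (connected_insert (connected_insert
      (connected_image_path (fun i hi => hp.adj i (by omega))) ⟨0, Nat.zero_le _, rfl⟩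
      hp.adj_zero.symm) (mem_insert _ _) hp.adj_last) hc.1.fin
    (mem_insert_of_mem _ (mem_insert_of_mem _ ⟨m, Nat.le_refl m, rfl⟩))
    (by
      rintro (e | e | ⟨i, hi, e⟩)
      · exact hp.inj _ _ (by omega) le_rfl e
      · exact hp.ne _ (by omega) e
      · exact hp.inj i (m + 1) (Nat.lt_succ_of_le hi) (by omega) e)
    (hp.adj m (by omega))
    (by
      rintro f (rfl | rfl | ⟨i, hi, rfl⟩) e
      · exact absurd e (hp.induced _ _ (by omega) (by omega))
      · exact absurd e.symm (hp.not_adj _ (by omega) (by omega))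
      · have hi' : i ≤ m := hi
        rcases Nat.lt_or_ge i m with hlt | hge
        · exact absurd e.symm (hp.induced _ _ (by omega) (by omega))
        · rw [le_antisymm hi' hge])
    (hp.adj _ (by omega)) (hp.inj _ _ (by omega) (by omega)).symm
  have hgq : g q = q := hg1 q (mem_insert_of_mem _ (mem_insert _ _))
  have hg0 : g (p 0) = p 0 :=
    hg1 _ (mem_insert_of_mem _ (mem_insert_of_mem _ ⟨0, Nat.zero_le _, rfl⟩))
  have hgn : g (p (m + 3)) = p (m + 3) := hg1 _ (mem_insert _ _)
  have hp' := hp.map g hgq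
  set r : ℕ → V := fun i => g (p i) with hr
  have hr0 : r 0 ∉ B := by rw [hr]; simpa only [hg0] using h0
  have hrn : r (m + 3) ∉ A := by rw [hr]; simpa only [hgn] using hlast
  have hpB : r (m + 2) ∉ A := by
    intro hA
    refine hg2 ⟨hA, ?_⟩
    by_contra hB
    exact hc.1.noedge _ _ (hp'.adj (m + 2) (by omega)) hB hrn
  obtain ⟨k, hk1, hk2, hk3⟩ := h.exists_moving he hm (S := A ∩ B)
    (F := r '' {i | i ≤ m + 2}) (y := r (m + 2)) (w := r (m + 3)) (w' := q)
    ((finite_le_nat (m + 2)).image r) (connected_image_path (fun i hi => hp'.adj i (by omega)))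
    hc.1.fin ⟨m + 2, Nat.le_refl _, rfl⟩
    (by
      rintro ⟨i, hi, e⟩
      exact hp'.inj i (m + 3) (Nat.lt_succ_of_le hi) le_rfl e)
    (hp'.adj _ (by omega))
    (by
      rintro _ ⟨i, hi, rfl⟩ e
      have hi' : i ≤ m + 2 := hi
      rcases Nat.lt_or_ge i (m + 2) with hlt | hge
      · exact absurd e.symm (hp'.induced _ _ (by omega) le_rfl)
      · rw [le_antisymm hi' hge])
    hp'.adj_last.symm (hp'.ne _ (by omega)).symm
  have e0 : G.Adj (r 0) (k q) := by
    have := k.map_adj_iff.2 hp'.adj_zero.symm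
    rwa [hk1 (r 0) ⟨0, Nat.zero_le _, rfl⟩] at this
  have e1 : G.Adj (k q) (k (r (m + 3))) := k.map_adj_iff.2 hp'.adj_last
  have e2 : G.Adj (k (r (m + 3))) (r (m + 2)) := by
    have := k.map_adj_iff.2 (hp'.adj (m + 2) (by omega)).symm
    rwa [hk1 (r (m + 2)) ⟨m + 2, Nat.le_refl _, rfl⟩] at this
  have step : ∀ x z, G.Adj x z → x ∉ B → z ∉ A ∩ B → z ∉ B := by
    intro x z hxz hx hz hzB
    refine hz ⟨?_, hzB⟩
    by_contra hzA
    exact hc.1.noedge _ _ hxz hx hzA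
  exact hc.1.noedge _ _ e2 (step _ _ e1 (step _ _ e0 hr0 hk3) hk2) hpB

theorem ConnHom.completeBlocks (h : ConnHom G E) (hends : MoreThanOneEnd G) :
    CompleteBlocks G := by
  have hm := exists_minCut hends
  by_cases hN : ∃ A B, MinCut G A B ∧ ∃ x y, x ∈ A ∩ B ∧ y ∈ A ∩ B ∧ G.Adj x y
  · exact h.completeBlocks_of_edgeCut (fun s t hst => h.exists_minCut_edge hN hst) hm
  · push Not at hN
    exact h.completeBlocks_of_independent hm hN

end EdgeCase

section Extension

variable {V : Type u} {G : SimpleGraph V} {E : V → V → Prop}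

/-- Any edge, seen from one of its ends, can be moved into the block of any other edge. -/
def FlagTransitive (G : SimpleGraph V) : Prop :=
  ∀ x k y l, G.Adj x k → G.Adj y l → ∃ ψ : G ≃g G, ψ x = y ∧ (ψ k = l ∨ G.Adj (ψ k) l)

theorem isolate_reachable_ne {q a b : V} (h : (isolate G q).Reachable a b) (ha : a ≠ q) :
    b ≠ q :=
  h.mem_of_closed (U := {v | v ≠ q}) ha (fun _ _ hxy _ => hxy.2.2)

theorem isolate_reachable_of_adj {q a b : V} (hab : G.Adj a b) (ha : a ≠ q) (hb : b ≠ q) :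
    (isolate G q).Reachable a b :=
  SimpleGraph.Adj.reachable (show (isolate G q).Adj a b from ⟨hab, ha, hb⟩)

theorem isolate_reachable_map (g : G ≃g G) {q a b : V} (h : (isolate G q).Reachable a b) :
    (isolate G (g q)).Reachable (g a) (g b) :=
  h.mem_of_closed (U := {v | (isolate G (g q)).Reachable (g a) (g v)})
    (SimpleGraph.Reachable.refl _) (fun _ _ hxy hx => SimpleGraph.Reachable.trans hx
      (isolate_reachable_of_adj (g.map_adj_iff.2 hxy.1) (fun e => hxy.2.1 (g.injective e))
        (fun e => hxy.2.2 (g.injective e))))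

theorem isolate_reachable_map_iff (g : G ≃g G) {q a b : V} :
    (isolate G (g q)).Reachable (g a) (g b) ↔ (isolate G q).Reachable a b := by
  refine ⟨fun h => ?_, isolate_reachable_map g⟩
  have := isolate_reachable_map g.symm h
  simpa using this

theorem exists_swapIso {U W : Set V} (g : G ≃g G) (hd : ∀ v, v ∈ U → v ∉ W)
    (hg : ∀ v, v ∈ U ↔ g v ∈ W) (hUW : ∀ u ∈ U, ∀ w ∈ W, G.Adj u w → G.Adj (g u) (g.symm w))
    (hU : ∀ u ∈ U, ∀ v, v ∉ U → v ∉ W → G.Adj u v → G.Adj (g u) v)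
    (hW : ∀ w ∈ W, ∀ v, v ∉ U → v ∉ W → G.Adj w v → G.Adj (g.symm w) v) :
    ∃ σ : G ≃g G, (∀ v ∈ U, σ v = g v) ∧ ∀ v, v ∉ U → v ∉ W → σ v = v := by
  classical
  set f : V → V := fun v => if v ∈ U then g v else if v ∈ W then g.symm v else v with hf
  have f1 : ∀ v, v ∈ U → f v = g v := fun v hv => if_pos hv
  have f2 : ∀ v, v ∈ W → f v = g.symm v := fun v hv =>
    (if_neg (fun h => hd v h hv)).trans (if_pos hv)
  have f3 : ∀ v, v ∉ U → v ∉ W → f v = v := fun v hv hv' => (if_neg hv).trans (if_neg hv')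
  have hinv : Function.Involutive f := by
    intro v
    by_cases hv : v ∈ U
    · rw [f1 v hv, f2 _ ((hg v).1 hv)]
      simp
    by_cases hv' : v ∈ W
    · rw [f2 v hv', f1 _ ((hg _).2 (by simpa using hv'))]
      simp
    · rw [f3 v hv hv', f3 v hv hv']
  have hadj : ∀ a b, G.Adj a b → G.Adj (f a) (f b) := by
    intro a b hab
    by_cases ha : a ∈ U
    · rw [f1 a ha]
      by_cases hb : b ∈ U
      · rw [f1 b hb]
        exact g.map_adj_iff.2 hab
      by_cases hb' : b ∈ W
      · rw [f2 b hb']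
        exact hUW a ha b hb' hab
      · rw [f3 b hb hb']
        exact hU a ha b hb hb' hab
    by_cases ha' : a ∈ W
    · rw [f2 a ha']
      by_cases hb : b ∈ U
      · rw [f1 b hb]
        exact (hUW b hb a ha' hab.symm).symm
      by_cases hb' : b ∈ W
      · rw [f2 b hb']
        exact g.symm.map_adj_iff.2 hab
      · rw [f3 b hb hb']
        exact hW a ha' b hb hb' hab
    · rw [f3 a ha ha']
      by_cases hb : b ∈ U
      · rw [f1 b hb]
        exact (hU b hb a ha ha' hab.symm).symm
      by_cases hb' : b ∈ W
      · rw [f2 b hb']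
        exact (hW b hb' a ha ha' hab.symm).symm
      · rwa [f3 b hb hb']
  refine ⟨⟨hinv.toPerm, fun {a b} => ⟨fun h => ?_, hadj a b⟩⟩, f1, f3⟩
  have h1 : G.Adj (f (f a)) (f (f b)) := hadj _ _ h
  rwa [hinv a, hinv b] at h1

theorem reachable_isolate_of_connected {X : Set V} (hX : (G.induce X).Connected) {q x y : V}
    (hq : q ∈ X) (hx : x ∉ X) (hxy : y ≠ x) (hqy : G.Adj q y) :
    ∀ z ∈ X, (isolate G x).Reachable y z := by
  have hne : ∀ z ∈ X, z ≠ x := fun z hz e => hx (e ▸ hz)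
  exact hX.subset_of_closed (U := {z | (isolate G x).Reachable y z}) hq
    (isolate_reachable_of_adj hqy.symm hxy (hne q hq))
    (fun a b ha hb hab h => SimpleGraph.Reachable.trans h
      (isolate_reachable_of_adj hab (hne a ha) (hne b hb)))

theorem CompleteBlocks.exists_swap_of_adj (hB : CompleteBlocks G) (hF : FlagTransitive G)
    (hG : G.Connected) {x y : V} (hxy : G.Adj x y) : ∃ σ : G ≃g G, σ x = y ∧
      ∀ v, (isolate G x).Reachable y v → (isolate G y).Reachable x v → σ v = v := by
  obtain ⟨g, hgx, hgy⟩ := hF x y y x hxy hxy.symm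
  have hgx' : g.symm y = x := by simp [← hgx]
  have hgyy : g y ≠ y := fun e => hxy.ne (g.injective (hgx.trans e.symm))
  have hreach : (isolate G y).Reachable (g y) x := by
    rcases hgy with e | e
    · rw [e]
    · exact isolate_reachable_of_adj e hgyy hxy.ne
  have hcov : ∀ v, (isolate G x).Reachable y v ∨ (isolate G y).Reachable x v := by
    intro v
    refine (hG.preconnected x v).mem_of_closed
      (U := {v | (isolate G x).Reachable y v ∨ (isolate G y).Reachable x v})
      (Or.inr (SimpleGraph.Reachable.refl _)) ?_
    rintro a b hab (h | h)
    · by_cases hb : b = x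
      · exact Or.inr (hb ▸ SimpleGraph.Reachable.refl _)
      · exact Or.inl (h.trans (isolate_reachable_of_adj hab
          (isolate_reachable_ne h hxy.ne') hb))
    · by_cases hb : b = y
      · exact Or.inl (hb ▸ SimpleGraph.Reachable.refl _)
      · exact Or.inr (h.trans (isolate_reachable_of_adj hab
          (isolate_reachable_ne h hxy.ne) hb))
  have leave : ∀ a b u v, a ≠ b → ¬ (isolate G a).Reachable b u → (isolate G a).Reachable b v →
      G.Adj u v → u = a := by
    intro a b u v hab hu hv huv
    by_contra hua
    exact hu (hv.trans (isolate_reachable_of_adj huv.symm (isolate_reachable_ne hv hab.symm) hua))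
  obtain ⟨σ, h1, h2⟩ := exists_swapIso (U := {v | ¬ (isolate G x).Reachable y v})
    (W := {v | ¬ (isolate G y).Reachable x v}) g (fun v hv hv' => (hcov v).elim hv hv')
    (by
      intro v
      refine not_congr ?_
      rw [← isolate_reachable_map_iff g, hgx]
      exact ⟨fun h => hreach.symm.trans h, fun h => hreach.trans h⟩)
    (by
      intro u hu w hw huw
      have hw' : (isolate G x).Reachable y w := (hcov w).resolve_right hw
      have hu' : (isolate G y).Reachable x u := (hcov u).resolve_left hu
      obtain rfl := leave x y u w hxy.ne hu hw' huw
      obtain rfl := leave y u w u hxy.ne' hw hu' huw.symm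
      rw [hgx, hgx']
      exact hxy.symm)
    (by
      intro u hu v hvU hvW huv
      have hv : (isolate G x).Reachable y v := not_not.1 hvU
      obtain rfl := leave x y u v hxy.ne hu hv huv
      rw [hgx]
      rcases hB u y v hxy huv hv with e | e
      · subst e
        exact absurd (fun h => isolate_reachable_ne h hxy.ne rfl) hvW
      · exact e)
    (by
      intro w hw v hvU hvW hwv
      have hv : (isolate G y).Reachable x v := not_not.1 hvW
      obtain rfl := leave y x w v hxy.ne' hw hv hwv
      rw [hgx']
      rcases hB w x v hxy.symm hwv hv with e | e
      · subst e
        exact absurd (fun h => isolate_reachable_ne h hxy.ne' rfl) hvU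
      · exact e)
  refine ⟨σ, ?_, fun v hv hv' => h2 v (not_not.2 hv) (not_not.2 hv')⟩
  rw [h1 x (fun h => isolate_reachable_ne h hxy.ne' rfl), hgx]

theorem CompleteBlocks.exists_fixing (hB : CompleteBlocks G) (hF : FlagTransitive G)
    (hG : G.Connected) {X : Set V} (hX : (G.induce X).Connected) {q x y : V} (hq : q ∈ X)
    (hx : x ∉ X) (hy : y ∉ X) (hqx : G.Adj q x) (hxy : ∀ z ∈ X, G.Adj x z ↔ G.Adj y z) :
    ∃ σ : G ≃g G, (∀ z ∈ X, σ z = z) ∧ σ x = y := by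
  have adjcase : ∀ {x y : V}, x ∉ X → y ∉ X → G.Adj q x → G.Adj q y → G.Adj x y →
      ∃ σ : G ≃g G, (∀ z ∈ X, σ z = z) ∧ σ x = y := by
    intro x y hx hy hqx hqy hadj
    obtain ⟨σ, h1, h2⟩ := hB.exists_swap_of_adj hF hG hadj
    exact ⟨σ, fun z hz => h2 z (reachable_isolate_of_connected hX hq hx hadj.ne' hqy z hz)
      (reachable_isolate_of_connected hX hq hy hadj.ne hqx z hz), h1⟩
  have hqy : G.Adj q y := ((hxy q hq).1 hqx.symm).symm
  by_cases hne : x = y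
  · subst hne
    exact ⟨RelIso.refl _, fun z _ => rfl, rfl⟩
  by_cases hadj : G.Adj x y
  · exact adjcase hx hy hqx hqy hadj
  have hsep : ¬ (isolate G q).Reachable x y := fun h => (hB q x y hqx hqy h).elim hne hadj
  obtain ⟨g, hgq, hgx⟩ := hF q x q y hqx hqy
  have hgxq : g x ≠ q := fun e => hqx.ne' (g.injective (e.trans hgq.symm))
  have hgx' : (isolate G q).Reachable (g x) y := by
    rcases hgx with e | e
    · rw [e]
    · exact isolate_reachable_of_adj e hgxq hqy.ne'
  have hgq' : g.symm q = q := by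
    conv_lhs => rw [← hgq]
    simp
  have leave : ∀ a u v, a ≠ q → (isolate G q).Reachable a u → ¬ (isolate G q).Reachable a v →
      G.Adj u v → v = q := by
    intro a u v ha hu hv huv
    by_contra hvq
    exact hv (hu.trans (isolate_reachable_of_adj huv (isolate_reachable_ne hu ha) hvq))
  have hXU : ∀ a b, a ∉ X → G.Adj q a → G.Adj q b → (∀ z ∈ X, G.Adj a z → G.Adj b z) →
      ¬ (isolate G q).Reachable a b → ∀ z ∈ X, ¬ (isolate G q).Reachable a z := by
    intro a b ha hqa hqb hab hnr
    refine hX.subset_of_closed (U := {z | ¬ (isolate G q).Reachable a z}) hq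
      (fun h => isolate_reachable_ne h hqa.ne' rfl) (fun u v hu hv huv hnu hav => ?_)
    obtain rfl := leave a v u hqa.ne' hav hnu huv.symm
    rcases hB u a v hqa huv hav with e | e
    · exact ha (e ▸ hv)
    · exact hnr (hav.trans (isolate_reachable_of_adj (hab v hv e).symm huv.ne' hqb.ne'))
  have hX1 := hXU x y hx hqx hqy (fun z hz => (hxy z hz).1) hsep
  have hX2 := hXU y x hy hqy hqx (fun z hz => (hxy z hz).2) (fun h => hsep h.symm)
  obtain ⟨σ, h1, h2⟩ := exists_swapIso (U := {v | (isolate G q).Reachable x v})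
    (W := {v | (isolate G q).Reachable y v}) g (fun v hv hv' => hsep (hv.trans hv'.symm))
    (by
      intro v
      show (isolate G q).Reachable x v ↔ (isolate G q).Reachable y (g v)
      rw [← isolate_reachable_map_iff g, hgq]
      exact ⟨fun h => hgx'.symm.trans h, fun h => hgx'.trans h⟩)
    (by
      intro u hu w hw huw
      exact absurd (leave x u w hqx.ne' hu (fun h => hsep (h.trans hw.symm)) huw)
        (isolate_reachable_ne hw hqy.ne'))
    (by
      intro u hu v hvU hvW huv
      obtain rfl := leave x u v hqx.ne' hu hvU huv
      have := g.map_adj_iff.2 huv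
      rwa [hgq] at this)
    (by
      intro w hw v hvU hvW hwv
      obtain rfl := leave y w v hqy.ne' hw hvW hwv
      have := g.symm.map_adj_iff.2 hwv
      rwa [hgq'] at this)
  have hσX : ∀ z ∈ X, σ z = z := fun z hz => h2 z (hX1 z hz) (hX2 z hz)
  have hσx : σ x = g x := h1 x (SimpleGraph.Reachable.refl _)
  rcases hgx with e | e
  · exact ⟨σ, hσX, hσx.trans e⟩
  · have hqgx : G.Adj q (g x) := by
      have := g.map_adj_iff.2 hqx
      rwa [hgq] at this
    obtain ⟨τ, h3, h4⟩ := adjcase (fun hz => hX2 _ hz hgx'.symm) hy hqgx hqy e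
    refine ⟨σ.trans τ, fun z hz => ?_, ?_⟩
    · show τ (σ z) = z
      rw [hσX z hz, h3 z hz]
    · show τ (σ x) = y
      rw [hσx, h4]

theorem CompleteBlocks.graphCHom (hB : CompleteBlocks G) (hF : FlagTransitive G)
    (hT : ∀ x y, ∃ ψ : G ≃g G, ψ x = y) (hG : G.Connected) : GraphCHom G := by
  intro X Y hXf _ hX φ hφ
  obtain ⟨x₀⟩ := hX.nonempty
  have key : ∀ n : ℕ, ∃ X₀ : Set V, ∃ hsub : X₀ ⊆ X, (G.induce X₀).Connected ∧
      (∃ ψ : G ≃g G, ∀ a (ha : a ∈ X₀), ψ a = φ ⟨a, hsub ha⟩) ∧ (X₀ = X ∨ n ≤ X₀.ncard) := by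
    intro n
    induction n with
    | zero =>
      obtain ⟨ψ, hψ⟩ := hT x₀.1 (φ x₀).1
      refine ⟨{x₀.1}, singleton_subset_iff.2 x₀.2, ?_, ⟨ψ, ?_⟩, Or.inr (Nat.zero_le _)⟩
      · refine SimpleGraph.connected_induce_of_forall_reachable (mem_singleton _)
          (fun U hU _ => singleton_subset_iff.2 hU)
      · intro a ha
        obtain rfl : a = x₀.1 := ha
        exact hψ
    | succ n ih =>
      obtain ⟨X₀, hsub, hc, ⟨ψ, hψ⟩, hor⟩ := ih
      by_cases hXX : X₀ = X
      · exact ⟨X₀, hsub, hc, ⟨ψ, hψ⟩, Or.inl hXX⟩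
      have hn := hor.resolve_left hXX
      obtain ⟨q, x, hq, hxX, hx, hqx⟩ : ∃ q x, q ∈ X₀ ∧ x ∈ X ∧ x ∉ X₀ ∧ G.Adj q x := by
        by_contra hcon
        push Not at hcon
        obtain ⟨c⟩ := hc.nonempty
        refine hXX (Subset.antisymm hsub (hX.subset_of_closed (hsub c.2) c.2 ?_))
        intro a b _ hb hab ha
        by_contra hb'
        exact hcon a b ha hb hb' hab
      set y := ψ.symm (φ ⟨x, hxX⟩).1 with hy
      have hψy : ψ y = φ ⟨x, hxX⟩ := by simp [hy]
      have hyX : y ∉ X₀ := by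
        intro h
        have e : φ ⟨y, hsub h⟩ = φ ⟨x, hxX⟩ := Subtype.ext ((hψ y h).symm.trans hψy)
        have e' : y = x := congrArg Subtype.val (φ.injective e)
        exact hx (e' ▸ h)
      obtain ⟨σ, h1, h2⟩ := hB.exists_fixing hF hG hc hq hx hyX hqx (by
        intro z hz
        rw [← ψ.map_adj_iff (v := y), hψy, hψ z hz]
        exact hφ ⟨x, hxX⟩ ⟨z, hsub hz⟩)
      refine ⟨insert x X₀, insert_subset hxX hsub, connected_insert hc hq hqx,
        ⟨σ.trans ψ, ?_⟩, Or.inr ?_⟩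
      · rintro a (rfl | ha)
        · show ψ (σ a) = _
          rw [h2, hψy]
        · show ψ (σ a) = _
          rw [h1 a ha, hψ a ha]
      · rw [ncard_insert_of_notMem hx (hXf.subset hsub)]
        omega
  obtain ⟨X₀, hsub, -, ⟨ψ, hψ⟩, hor⟩ := key (X.ncard + 1)
  have hle := ncard_le_ncard hsub hXf
  obtain rfl : X₀ = X := hor.resolve_right (by omega)
  exact ⟨ψ, fun a => hψ a.1 a.2⟩

theorem ConnHom.flagTransitive (h : ConnHom G E) (hB : CompleteBlocks G) : FlagTransitive G := by
  intro x k y l hxk hyl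
  obtain ⟨a, hxa, ha⟩ := h.near_out x k hxk
  obtain ⟨b, hyb, hb⟩ := h.near_out y l hyl
  obtain ⟨ψ, -, h1, h2⟩ := h.edge_transitive (Or.inl ⟨hxa, hyb⟩)
  refine ⟨ψ, h1, ?_⟩
  have hψk : G.Adj y (ψ k) := h1 ▸ ψ.map_adj_iff.2 hxk
  have r1 : (isolate G y).Reachable b (ψ k) := by
    rcases ha with rfl | e
    · rw [h2]
    · exact isolate_reachable_of_adj (h2 ▸ ψ.map_adj_iff.2 e) (h.adj_out hyb).ne' hψk.ne'
  have r2 : (isolate G y).Reachable b l := by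
    rcases hb with rfl | e
    · exact SimpleGraph.Reachable.refl _
    · exact isolate_reachable_of_adj e (h.adj_out hyb).ne' hyl.ne'
  exact hB y _ _ hψk hyl (r1.symm.trans r2)

theorem ConnHom.graphCHom (h : ConnHom G E) (hends : MoreThanOneEnd G) : GraphCHom G :=
  have hB := h.completeBlocks hends
  hB.graphCHom (h.flagTransitive hB)
    (fun x y => let ⟨ψ, _, hψ⟩ := h.vertex_transitive x y; ⟨ψ, hψ⟩) h.conn

end Extension

section Instances

variable {V : Type u} {G : SimpleGraph V} {E : V → V → Prop}

theorem GraphCHom.connHom (h : GraphCHom G) (hG : G.Connected) : ConnHom G G.Adj where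
  adj a b := ⟨Or.inl, fun h => h.elim id SimpleGraph.Adj.symm⟩
  symm_or := Or.inl (fun _ _ h => h.symm)
  extend X hX hc f hf hE := by
    obtain ⟨ψ, hψ⟩ := h X (f '' X) hX (hX.image f) hc (Equiv.Set.imageOfInjOn f X hf)
      (fun a b => (hE a.1 a.2 b.1 b.2).symm)
    exact ⟨ψ, fun x y => ψ.map_adj_iff, fun a ha => hψ ⟨a, ha⟩⟩
  near_out s y hsy := ⟨y, hsy, Or.inl rfl⟩
  near_in s y hsy := ⟨y, hsy.symm, Or.inl rfl⟩
  conn := hG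

theorem IsDigraph.ug_adj_iff (hD : IsDigraph E) {a b : V} : (UG E).Adj a b ↔ E a b ∨ E b a := by
  simp only [UG, SimpleGraph.fromRel_adj]
  refine ⟨And.right, fun h => ⟨?_, h⟩⟩
  rintro rfl
  exact h.elim (hD.1 a) (hD.1 a)

theorem DigraphCHom.extend (hD : IsDigraph E) (h : DigraphCHom E) (X : Set V) (hX : X.Finite)
    (hc : ((UG E).induce X).Connected) (f : V → V) (hf : InjOn f X)
    (hE : ∀ a ∈ X, ∀ b ∈ X, E (f a) (f b) ↔ E a b) :
    ∃ ψ : UG E ≃g UG E, (∀ x y, E (ψ x) (ψ y) ↔ E x y) ∧ ∀ a ∈ X, ψ a = f a := by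
  obtain ⟨ψ, h1, h2⟩ := h X (f '' X) hX (hX.image f) hc (Equiv.Set.imageOfInjOn f X hf)
    (fun a b => (hE a.1 a.2 b.1 b.2).symm)
  refine ⟨⟨ψ, fun {a b} => ?_⟩, h1, fun a ha => h2 ⟨a, ha⟩⟩
  rw [hD.ug_adj_iff, hD.ug_adj_iff, h1, h1]

theorem DigraphCHom.exists_iso_apply (hD : IsDigraph E) (h : DigraphCHom E) (x y : V) :
    ∃ ψ : UG E ≃g UG E, ψ x = y := by
  obtain ⟨ψ, -, h2⟩ := h.extend hD {x} (finite_singleton x)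
    (SimpleGraph.connected_induce_of_forall_reachable (mem_singleton x)
      (fun U hU _ => singleton_subset_iff.2 hU)) (fun _ => y) (injOn_singleton _ _) (by
      rintro a rfl b rfl
      exact iff_of_false (hD.1 _) (hD.1 _))
  exact ⟨ψ, h2 x rfl⟩

theorem DigraphCHom.exists_iso_apply_edge (hD : IsDigraph E) (h : DigraphCHom E) {a b x y : V}
    (hab : E a b) (hxy : E x y) :
    ∃ ψ : UG E ≃g UG E, (∀ x y, E (ψ x) (ψ y) ↔ E x y) ∧ ψ a = x ∧ ψ b = y := by
  classical
  have hne : b ≠ a := fun e => hD.1 a (e ▸ hab)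
  have hne' : x ≠ y := fun e => hD.1 x (e ▸ hxy)
  have fa : (if a = a then x else y) = x := if_pos rfl
  have fb : (if b = a then x else y) = y := if_neg hne
  obtain ⟨ψ, h1, h2⟩ := h.extend hD {a, b} (toFinite _)
    (SimpleGraph.connected_induce_of_forall_reachable (mem_insert a {b}) (fun U hU hcl =>
      insert_subset hU (singleton_subset_iff.2 (hcl a b (by simp) (by simp)
        (hD.ug_adj_iff.2 (Or.inl hab)) hU))))
    (fun z => if z = a then x else y) (by
      rintro u (rfl | rfl) v (rfl | rfl) huv
      · rfl
      · simp only [fb] at huv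
        exact absurd huv hne'
      · simp only [fb] at huv
        exact absurd huv.symm hne'
      · rfl) (by
      rintro u (rfl | rfl) v (rfl | rfl)
      · simp only
        exact iff_of_false (hD.1 _) (hD.1 _)
      · simp only [fb]
        exact iff_of_true hxy hab
      · simp only [fb]
        exact iff_of_false (hD.2 _ _ hxy) (hD.2 _ _ hab)
      · simp only [fb]
        exact iff_of_false (hD.1 _) (hD.1 _))
  exact ⟨ψ, h1, (h2 a (by simp)).trans fa, (h2 b (by simp)).trans fb⟩

theorem IsDigraph.exists_path_of_hasTriangle (hD : IsDigraph E) (hT : HasTriangle E) :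
    ∃ a b c, E a b ∧ E b c ∧ (UG E).Adj a c := by
  obtain ⟨x, y, z, hxy, hyz, hxz⟩ := hT
  rcases hD.ug_adj_iff.1 hxy with h1 | h1 <;> rcases hD.ug_adj_iff.1 hyz with h2 | h2
  · exact ⟨x, y, z, h1, h2, hxz⟩
  · rcases hD.ug_adj_iff.1 hxz with h3 | h3
    · exact ⟨x, z, y, h3, h2, hxy⟩
    · exact ⟨z, x, y, h3, h1, hyz.symm⟩
  · rcases hD.ug_adj_iff.1 hxz with h3 | h3
    · exact ⟨y, x, z, h1, h3, hyz⟩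
    · exact ⟨y, z, x, h2, h3, hxy.symm⟩
  · exact ⟨z, y, x, h2, h1, hxz.symm⟩

theorem DigraphCHom.connHom (hD : IsDigraph E) (h : DigraphCHom E) (hG : (UG E).Connected)
    (hT : HasTriangle E) : ConnHom (UG E) E where
  adj _ _ := hD.ug_adj_iff
  symm_or := Or.inr hD.2
  extend := h.extend hD
  near_out s y hsy := by
    obtain ⟨a, b, c, hab, hbc, hac⟩ := hD.exists_path_of_hasTriangle hT
    rcases hD.ug_adj_iff.1 hsy with e | e
    · exact ⟨y, e, Or.inl rfl⟩
    · obtain ⟨ψ, h1, rfl, rfl⟩ := h.exists_iso_apply_edge hD hab e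
      exact ⟨ψ c, (h1 _ _).2 hbc, Or.inr (ψ.map_adj_iff.2 hac.symm)⟩
  near_in s y hsy := by
    obtain ⟨a, b, c, hab, hbc, hac⟩ := hD.exists_path_of_hasTriangle hT
    rcases hD.ug_adj_iff.1 hsy with e | e
    · obtain ⟨ψ, h1, rfl, rfl⟩ := h.exists_iso_apply_edge hD hbc e
      exact ⟨ψ a, (h1 _ _).2 hab, Or.inr (ψ.map_adj_iff.2 hac)⟩
    · exact ⟨y, e, Or.inl rfl⟩
  conn := hG

theorem CompleteBlocks.isAcyclic (hB : CompleteBlocks G)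
    (hT : ∀ x y z, G.Adj x y → G.Adj y z → ¬ G.Adj x z) : G.IsAcyclic := by
  rw [SimpleGraph.isAcyclic_iff_forall_adj_isBridge]
  intro v w hvw
  rw [SimpleGraph.isBridge_iff]
  intro hr
  have := hr.mem_of_closed
    (U := {z | z = v ∨ ∃ a, G.Adj v a ∧ a ≠ w ∧ (isolate G v).Reachable a z}) (Or.inl rfl) ?_
  · rcases this with e | ⟨a, hva, haw, ha⟩
    · exact hvw.ne' e
    · rcases hB v a w hva hvw ha with e | e
      · exact haw e
      · exact hT v a w hva e hvw
  · rintro z b hzb hz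
    rw [SimpleGraph.deleteEdges_adj] at hzb
    rcases hz with rfl | ⟨a, hva, haw, ha⟩
    · refine Or.inr ⟨b, hzb.1, ?_, SimpleGraph.Reachable.refl _⟩
      rintro rfl
      exact hzb.2 rfl
    · by_cases hb : b = v
      · exact Or.inl hb
      · exact Or.inr ⟨a, hva, haw, ha.trans
          (isolate_reachable_of_adj hzb.1 (isolate_reachable_ne ha hva.ne') hb)⟩

/-- Distinct neighbours of a vertex of a forest are separated by that vertex. -/
theorem SimpleGraph.IsAcyclic.eq_of_isolate_reachable (hA : G.IsAcyclic) {q a b : V}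
    (ha : G.Adj q a) (hb : G.Adj q b) (hr : (isolate G q).Reachable a b) : a = b := by
  rw [SimpleGraph.isAcyclic_iff_forall_adj_isBridge] at hA
  by_contra hne
  refine SimpleGraph.isBridge_iff.1 (hA ha) ?_
  have h1 : (G.deleteEdges {s(q, a)}).Adj q b := by
    rw [SimpleGraph.deleteEdges_adj]
    refine ⟨hb, ?_⟩
    simp only [mem_singleton_iff, Sym2.eq_iff]
    rintro (⟨-, h⟩ | ⟨h, -⟩)
    · exact hne h.symm
    · exact ha.ne h
  refine h1.reachable.trans (hr.symm.mono ?_)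
  intro x y hxy
  rw [SimpleGraph.deleteEdges_adj]
  refine ⟨hxy.1, ?_⟩
  simp only [mem_singleton_iff, Sym2.eq_iff]
  rintro (⟨h, -⟩ | ⟨-, h⟩)
  · exact hxy.2.1 h
  · exact hxy.2.2 h

theorem SimpleGraph.IsAcyclic.completeBlocks (hA : G.IsAcyclic) : CompleteBlocks G :=
  fun _ _ _ ha hb hr => Or.inl (hA.eq_of_isolate_reachable ha hb hr)

end Instances

section Tree

variable {V : Type u} {G : SimpleGraph V}

theorem isolate_reachable_of_dist_le (hG : G.Connected) {x u w : V}
    (hd : G.dist x u ≤ G.dist x w) (huw : u ≠ w) : (isolate G w).Reachable x u := by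
  obtain ⟨p, h0, h1, hadj, hwalk, -⟩ := (hG.preconnected x u).exists_geodesic
  have hne : ∀ i, i ≤ G.dist x u → p i ≠ w := by
    intro i hi hpi
    obtain ⟨q, hq⟩ := hwalk 0 i (Nat.zero_le i) hi
    have hle := G.dist_le q
    rw [hq, h0, hpi] at hle
    obtain rfl : i = G.dist x u := by omega
    exact huw (h1.symm.trans hpi)
  have key : ∀ i, i ≤ G.dist x u → (isolate G w).Reachable x (p i) := by
    intro i
    induction i with
    | zero =>
      intro _
      rw [h0]
    | succ i ih =>
      intro hi
      exact (ih (by omega)).trans (isolate_reachable_of_adj (hadj i (by omega))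
        (hne i (by omega)) (hne _ hi))
  have := key _ (Nat.le_refl _)
  rwa [h1] at this

/-- In a tree every vertex has at most one neighbour that is not farther from the root. -/
theorem SimpleGraph.IsTree.eq_of_dist_le (hT : G.IsTree) {x u u' w : V} (hu : G.Adj u w)
    (hu' : G.Adj u' w) (hd : G.dist x u ≤ G.dist x w) (hd' : G.dist x u' ≤ G.dist x w) :
    u = u' :=
  hT.isAcyclic.eq_of_isolate_reachable hu.symm hu'.symm
    ((isolate_reachable_of_dist_le hT.connected hd hu.ne).symm.trans
      (isolate_reachable_of_dist_le hT.connected hd' hu'.ne))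

theorem SimpleGraph.Connected.exists_adj_dist (hG : G.Connected) {x v : V} (hv : v ≠ x) :
    ∃ u, G.Adj u v ∧ G.dist x u + 1 = G.dist x v := by
  obtain ⟨p, h0, h1, hadj, hwalk, -, -⟩ := (hG.preconnected x v).exists_geodesic
  have hpos : G.dist x v ≠ 0 := fun e => hv ((hG.dist_eq_zero_iff).1 e).symm
  obtain ⟨n, hn⟩ := Nat.exists_eq_succ_of_ne_zero hpos
  have hn' : n + 1 = G.dist x v := hn.symm
  have ha := hadj n (by omega)
  rw [hn', h1] at ha
  obtain ⟨q, hq⟩ := hwalk 0 n (Nat.zero_le n) (by omega)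
  have h2 := G.dist_le q
  rw [hq, h0] at h2
  obtain ⟨r, hr⟩ := (hG.preconnected x (p n)).exists_walk_length_eq_dist
  have h3 := G.dist_le (r.concat ha)
  rw [SimpleGraph.Walk.length_concat] at h3
  exact ⟨p n, ha, by omega⟩

/-- In a tree a walk without backtracking moves away from its start. -/
theorem SimpleGraph.IsTree.dist_of_not_backtrack (hT : G.IsTree) (p : ℕ → V) (n : ℕ)
    (hp : ∀ i < n, G.Adj (p i) (p (i + 1))) (hb : ∀ i, i + 1 < n → p i ≠ p (i + 2)) :
    ∀ i < n, G.dist (p 0) (p i) < G.dist (p 0) (p (i + 1)) := by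
  intro i
  induction i with
  | zero =>
    intro h
    rw [SimpleGraph.dist_self]
    exact hT.connected.pos_dist_of_ne (hp 0 h).ne
  | succ i ih =>
    intro h
    by_contra hlt
    exact hb i h (hT.eq_of_dist_le (hp i (by omega)) (hp (i + 1) h).symm
      (ih (by omega)).le (not_lt.1 hlt))

/-- A map from a tree to itself that is bijective between neighbourhoods is an automorphism. -/
theorem SimpleGraph.IsTree.exists_iso_of_bijOn (hT : G.IsTree) (f : V → V)
    (hf : ∀ u, BijOn f (G.neighborSet u) (G.neighborSet (f u))) :
    ∃ ψ : G ≃g G, ∀ v, ψ v = f v := by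
  have hadj : ∀ a b, G.Adj a b → G.Adj (f a) (f b) := fun a b hab => (hf a).mapsTo hab
  have hinj : Function.Injective f := by
    intro v w hvw
    by_contra hne
    obtain ⟨p, h0, h1, hpadj, -, hpinj, -⟩ :=
      (hT.connected.preconnected v w).exists_geodesic
    have hpos := hT.connected.pos_dist_of_ne hne
    have hlt := hT.dist_of_not_backtrack (fun i => f (p i)) (G.dist v w)
      (fun i hi => hadj _ _ (hpadj i hi)) (fun i hi e => by
        have := hpinj i (i + 2) (by omega) (by omega)
          ((hf (p (i + 1))).injOn (hpadj i (by omega)).symm (hpadj (i + 1) hi) e)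
        omega) (G.dist v w - 1) (by omega)
    rw [show G.dist v w - 1 + 1 = G.dist v w by omega] at hlt
    simp only [h0, h1] at hlt
    rw [← hvw, SimpleGraph.dist_self] at hlt
    omega
  have hsurj : Function.Surjective f := by
    intro z
    obtain ⟨c⟩ := hT.connected.nonempty
    refine (hT.connected.preconnected (f c) z).mem_of_closed (U := range f) ⟨c, rfl⟩ ?_
    rintro _ b hab ⟨a, rfl⟩
    obtain ⟨d, -, hd⟩ := (hf a).surjOn hab
    exact ⟨d, hd⟩
  refine ⟨⟨Equiv.ofBijective f ⟨hinj, hsurj⟩, fun {a b} => ⟨fun hab => ?_, hadj a b⟩⟩,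
    fun v => rfl⟩
  obtain ⟨c, hc, hcb⟩ := (hf a).surjOn (show f b ∈ G.neighborSet (f a) from hab)
  exact hinj hcb ▸ hc

theorem SimpleGraph.exists_bijOn_neighborSet (hV : ∀ x y, ∃ ψ : G ≃g G, ψ x = y) (u u' w w' : V) :
    ∃ b : V → V, G.Adj u u' → G.Adj w w' →
      BijOn b (G.neighborSet u) (G.neighborSet w) ∧ b u' = w' := by
  classical
  obtain ⟨ψ, hψ⟩ := hV u w
  refine ⟨fun z => Equiv.swap (ψ u') w' (ψ z), fun hu hw => ⟨?_, Equiv.swap_apply_left _ _⟩⟩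
  have hψu' : G.Adj w (ψ u') := hψ ▸ ψ.map_adj_iff.2 hu
  have hs : ∀ z, G.Adj w (Equiv.swap (ψ u') w' z) ↔ G.Adj w z := by
    intro z
    by_cases h1 : z = ψ u'
    · rw [h1, Equiv.swap_apply_left]
      exact iff_of_true hw hψu'
    by_cases h2 : z = w'
    · rw [h2, Equiv.swap_apply_right]
      exact iff_of_true hψu' hw
    · rw [Equiv.swap_apply_of_ne_of_ne h1 h2]
  refine ⟨fun z hz => (hs _).2 (hψ ▸ ψ.map_adj_iff.2 hz),
    ((Equiv.swap _ _).injective.comp ψ.injective).injOn, fun z hz => ?_⟩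
  refine ⟨ψ.symm (Equiv.swap (ψ u') w' z), ?_, by simp⟩
  have h1 := ψ.symm.map_adj_iff.2 ((hs z).2 hz)
  rwa [← hψ, RelIso.symm_apply_apply] at h1

theorem SimpleGraph.IsTree.flagTransitive (hT : G.IsTree)
    (hV : ∀ x y, ∃ ψ : G ≃g G, ψ x = y) : FlagTransitive G := by
  intro x k y l hxk hyl
  choose b hb using SimpleGraph.exists_bijOn_neighborSet hV
  have hpar : ∀ v, ∃ u, G.Adj v u ∧ (v = x → u = k) ∧ (v ≠ x → G.dist x u + 1 = G.dist x v) := by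
    intro v
    by_cases hv : v = x
    · exact ⟨k, hv ▸ hxk, fun _ => rfl, fun h => absurd hv h⟩
    · obtain ⟨u, h1, h2⟩ := hT.connected.exists_adj_dist hv
      exact ⟨u, h1.symm, fun h => absurd h hv, fun _ => h2⟩
  choose par hparadj hparx hpard using hpar
  let F : ℕ → V → V × V := fun n => Nat.rec (fun _ => (y, l))
    (fun _ F v => (b (par v) (par (par v)) (F (par v)).1 (F (par v)).2 v, (F (par v)).1)) n
  set f : V → V := fun v => (F (G.dist x v) v).1 with hf
  set g : V → V := fun v => (F (G.dist x v) v).2 with hg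
  have hstep : ∀ v, v ≠ x →
      f v = b (par v) (par (par v)) (f (par v)) (g (par v)) v ∧ g v = f (par v) := by
    intro v hv
    simp only [hf, hg]
    rw [← hpard v hv]
    exact ⟨rfl, rfl⟩
  have hfx : f x = y := by simp [hf, F]
  have hgx : g x = l := by simp [hg, F]
  have hfg : ∀ n v, G.dist x v = n → G.Adj (f v) (g v) := by
    intro n
    induction n with
    | zero =>
      intro v hv
      obtain rfl := hT.connected.dist_eq_zero_iff.1 hv
      rw [hfx, hgx]
      exact hyl
    | succ n ih =>
      intro v hv
      have hvx : v ≠ x := by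
        rintro rfl
        simp at hv
      have hp := hpard v hvx
      rw [(hstep v hvx).1, (hstep v hvx).2]
      exact (((hb (par v) (par (par v)) (f (par v)) (g (par v))) (hparadj _)
        (ih _ (by omega))).1.mapsTo (hparadj v).symm).symm
  have hB := fun u => hb u (par u) (f u) (g u) (hparadj u) (hfg _ u rfl)
  have hpar_of : ∀ u w, G.Adj u w → G.dist x u ≤ G.dist x w → w ≠ x ∧ par w = u := by
    intro u w huw hd
    have hwx : w ≠ x := by
      rintro rfl
      rw [SimpleGraph.dist_self, Nat.le_zero] at hd
      exact huw.ne (hT.connected.dist_eq_zero_iff.1 hd).symm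
    have := hpard w hwx
    exact ⟨hwx, hT.eq_of_dist_le (hparadj w).symm huw (by omega) hd⟩
  have hchild : ∀ u w, w ≠ x → par w = u → f w = b u (par u) (f u) (g u) w := by
    rintro _ w hw rfl
    exact (hstep w hw).1
  have hfk : f k = l := by
    obtain ⟨hkx, hpk⟩ := hpar_of x k hxk (by simp)
    rw [hchild x k hkx hpk, ← hparx x rfl, (hB x).2, hgx]
  have hgp : ∀ v, g v = f (par v) := by
    intro v
    by_cases hv : v = x
    · rw [hv, hgx, hparx x rfl, hfk]
    · exact (hstep v hv).2
  obtain ⟨ψ, hψ⟩ := hT.exists_iso_of_bijOn f (fun u => (hB u).1.congr (by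
    intro w hw
    rcases le_total (G.dist x u) (G.dist x w) with h | h
    · obtain ⟨h1, h2⟩ := hpar_of u w hw h
      exact (hchild u w h1 h2).symm
    · obtain ⟨-, rfl⟩ := hpar_of w u (SimpleGraph.Adj.symm hw) h
      rw [(hB u).2, hgp]))
  exact ⟨ψ, (hψ x).trans hfx, Or.inl ((hψ k).trans hfk)⟩

end Tree

/-- A connected C-homogeneous digraph with more than one end is of Type I if and
only if its underlying graph is a tree or it contains a triangle. -/
theorem stmt_17 {V : Type u} (E : V → V → Prop) (hD : IsDigraph E)
    (hconn : (UG E).Connected) (hhom : DigraphCHom E)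
    (hends : MoreThanOneEnd (UG E)) :
    GraphCHom (UG E) ↔ ((UG E).IsTree ∨ HasTriangle E) := by
  constructor
  · intro h
    by_cases hT : HasTriangle E
    · exact Or.inr hT
    · exact Or.inl ⟨hconn, ((h.connHom hconn).completeBlocks hends).isAcyclic
        (fun x y z hxy hyz hxz => hT ⟨x, y, z, hxy, hyz, hxz⟩)⟩
  · rintro (h | h)
    · have hV := hhom.exists_iso_apply hD
      exact h.isAcyclic.completeBlocks.graphCHom (h.flagTransitive hV) hV hconn
    · exact (hhom.connHom hD hconn h).graphCHom hends
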